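/- arXiv:1901.07841 — 4 statements merged into one kernel-verified Lean document; each statement's English description precedes it below -/
import Mathlib

section
/- Convergence of the auxiliary penalized iterates: assume (H.1), (H.2), (H.3) and (H.4). Then for any fixed ρ ≥ 0, the iterates (u^{ρ,n})_{n≥0} defined by u^{ρ,0} = u⁰ and u^{ρ,n} = Q^ρ u^{ρ,n−1} converge monotonically from above (i.e., decreasing in n) to the bounded viscosity solution u^ρ of the penalized system with parameter ρ as n → ∞, uniformly on compact subsets of ℝ^d. -/
noncomputable section
open scoped BigOperators RealInnerProductSpace
open Filter Topology Matrix

namespace HJBQVI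

abbrev E (d : ℕ) : Type := EuclideanSpace ℝ (Fin d)

variable {d d' M : ℕ}

/-- Frobenius norm of a matrix. -/
def frobNorm (A : Matrix (Fin d) (Fin d') ℝ) : ℝ :=
  Real.sqrt (∑ k, ∑ l, (A k l) ^ 2)

/-- Hessian matrix of a real-valued function, via the second iterated Fréchet derivative. -/
def hess (φ : E d → ℝ) (x : E d) : Matrix (Fin d) (Fin d) ℝ :=
  Matrix.of fun i j =>
    iteratedFDeriv ℝ 2 φ x ![EuclideanSpace.single i (1 : ℝ), EuclideanSpace.single j (1 : ℝ)]

/-- Semiconcavity with constant `C`. -/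
def Semiconcave (φ : E d → ℝ) (C : ℝ) : Prop :=
  ∀ x h : E d, φ (x + h) - 2 * φ x + φ (x - h) ≤ C * ‖h‖ ^ 2

/-- Membership in `C⁰₁(ℝ^d)`: bounded, continuous, Lipschitz. -/
def InC01 (f : E d → ℝ) : Prop :=
  Continuous f ∧ (∃ C, ∀ x, |f x| ≤ C) ∧ ∃ L, ∀ x y, |f x - f y| ≤ L * ‖x - y‖

/-- Uniform boundedness of a system of functions. -/
def Bdd (u : Fin M → E d → ℝ) : Prop := ∃ C, ∀ i x, |u i x| ≤ C

/-- Coefficient data for the weakly coupled HJB operator. -/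
structure HJBData (d d' M : ℕ) (𝒜 : Type) [MetricSpace 𝒜] where
  A : Fin M → Set 𝒜
  σm : Fin M → 𝒜 → E d → Matrix (Fin d) (Fin d') ℝ
  bv : Fin M → 𝒜 → E d → E d
  cz : Fin M → 𝒜 → E d → ℝ
  runCost : Fin M → 𝒜 → E d → ℝ
  dcp : Fin M → Fin M → 𝒜 → E d → ℝ

variable {𝒜 𝒵 : Type} [MetricSpace 𝒜] [MetricSpace 𝒵]

/-- The linear operator `L^α_i(x, s, p, X)`. -/
def HJBData.L (P : HJBData d d' M 𝒜) (i : Fin M) (α : 𝒜) (x : E d)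
    (s : Fin M → ℝ) (p : E d) (X : Matrix (Fin d) (Fin d) ℝ) : ℝ :=
  - Matrix.trace (((1 : ℝ) / 2) • (P.σm i α x * (P.σm i α x)ᵀ) * X)
  - ⟪P.bv i α x, p⟫ + P.cz i α x * s i - P.runCost i α x
  - ∑ j ∈ Finset.univ.erase i, P.dcp i j α x * s j

/-- The Hamiltonian `sup_{α ∈ A_i} L^α_i`. -/
def HJBData.Ham (P : HJBData d d' M 𝒜) (i : Fin M) (x : E d)
    (s : Fin M → ℝ) (p : E d) (X : Matrix (Fin d) (Fin d) ℝ) : ℝ :=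
  sSup ((fun α => P.L i α x s p X) '' P.A i)

/-- Data of the impulse intervention operator. -/
structure ImpulseData (d M : ℕ) (𝒵 : Type) [MetricSpace 𝒵] where
  Z : Fin M → E d → Set 𝒵
  Γ : Fin M → E d → 𝒵 → E d
  K : Fin M → E d → 𝒵 → ℝ

/-- The intervention operator `(M_i u)(x) = min_{z ∈ Z_i(x)} [u_i(Γ_i(x,z)) + K_i(x,z)]`. -/
def ImpulseData.Mop (Q : ImpulseData d M 𝒵) (i : Fin M) (u : Fin M → E d → ℝ) (x : E d) : ℝ :=
  sInf ((fun z => u i (Q.Γ i x z) + Q.K i x z) '' Q.Z i x)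

/-- Type of (possibly nonlocal) degenerate elliptic operators. -/
abbrev Op (d M : ℕ) : Type :=
  Fin M → E d → (Fin M → E d → ℝ) → E d → Matrix (Fin d) (Fin d) ℝ → ℝ

/-- Viscosity subsolution (upper semicontinuous, tested from above by C² functions). -/
def IsSubsolution (F : Op d M) (u : Fin M → E d → ℝ) : Prop :=
  (∀ i, UpperSemicontinuous (u i)) ∧
  ∀ (i : Fin M) (φ : E d → ℝ), ContDiff ℝ 2 φ → ∀ x : E d,
    IsLocalMax (fun y => u i y - φ y) x → F i x u (gradient φ x) (hess φ x) ≤ 0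

/-- Viscosity supersolution. -/
def IsSupersolution (F : Op d M) (u : Fin M → E d → ℝ) : Prop :=
  (∀ i, LowerSemicontinuous (u i)) ∧
  ∀ (i : Fin M) (φ : E d → ℝ), ContDiff ℝ 2 φ → ∀ x : E d,
    IsLocalMin (fun y => u i y - φ y) x → 0 ≤ F i x u (gradient φ x) (hess φ x)

/-- Viscosity solution: continuous and both a sub- and a supersolution. -/
def IsSolution (F : Op d M) (u : Fin M → E d → ℝ) : Prop :=
  (∀ i, Continuous (u i)) ∧ IsSubsolution F u ∧ IsSupersolution F u

/-- Pure HJB operator. -/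
def Fhjb (P : HJBData d d' M 𝒜) : Op d M :=
  fun i x u p X => P.Ham i x (fun j => u j x) p X

/-- Obstacle problem operator with obstacle `Ψ`. -/
def Fob (P : HJBData d d' M 𝒜) (Ψ : Fin M → E d → ℝ) : Op d M :=
  fun i x u p X => max (P.Ham i x (fun j => u j x) p X) (u i x - Ψ i x)

/-- Penalized obstacle problem operator. -/
def FobPen (P : HJBData d d' M 𝒜) (Ψ : Fin M → E d → ℝ) (ρ : ℝ) : Op d M :=
  fun i x u p X => P.Ham i x (fun j => u j x) p X + ρ * max (u i x - Ψ i x) 0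

/-- The HJBQVI operator. -/
def Fqvi (P : HJBData d d' M 𝒜) (Q : ImpulseData d M 𝒵) : Op d M :=
  fun i x u p X => max (P.Ham i x (fun j => u j x) p X) (u i x - Q.Mop i u x)

/-- The penalized HJBQVI operator with penalty parameter `ρ`. -/
def Fpen (P : HJBData d d' M 𝒜) (Q : ImpulseData d M 𝒵) (ρ : ℝ) : Op d M :=
  fun i x u p X => P.Ham i x (fun j => u j x) p X + ρ * max (u i x - Q.Mop i u x) 0

/-- Assumption (H.1). -/
def H1 (P : HJBData d d' M 𝒜) (C lam0 : ℝ) : Prop :=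
  0 < lam0 ∧
  (∀ i, (P.A i).Nonempty ∧ IsCompact (P.A i)) ∧
  ∀ i, ∀ α ∈ P.A i,
    (∀ k l, Continuous fun x => P.σm i α x k l) ∧
    Continuous (P.bv i α) ∧ Continuous (P.cz i α) ∧ Continuous (P.runCost i α) ∧
    (∀ j, Continuous (P.dcp i j α)) ∧
    (∀ x, frobNorm (P.σm i α x) ≤ C) ∧
    (∀ x y, frobNorm (P.σm i α x - P.σm i α y) ≤ C * ‖x - y‖) ∧
    (∀ x, ‖P.bv i α x‖ ≤ C) ∧ (∀ x y, ‖P.bv i α x - P.bv i α y‖ ≤ C * ‖x - y‖) ∧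
    (∀ x, |P.cz i α x| ≤ C) ∧ (∀ x y, |P.cz i α x - P.cz i α y| ≤ C * ‖x - y‖) ∧
    (∀ x, |P.runCost i α x| ≤ C) ∧
    (∀ x y, |P.runCost i α x - P.runCost i α y| ≤ C * ‖x - y‖) ∧
    (∀ j, (∀ x, |P.dcp i j α x| ≤ C) ∧ ∀ x y, |P.dcp i j α x - P.dcp i j α y| ≤ C * ‖x - y‖) ∧
    (∀ j ∈ Finset.univ.erase i, ∀ x, 0 ≤ P.dcp i j α x) ∧
    ∀ x, lam0 ≤ P.cz i α x - ∑ j ∈ Finset.univ.erase i, P.dcp i j α x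

/-- Assumption (H.2). -/
def H2 (Q : ImpulseData d M 𝒵) (κ₀ : ℝ) : Prop :=
  0 < κ₀ ∧
  (∀ i x, (Q.Z i x).Nonempty ∧ IsCompact (Q.Z i x)) ∧
  (∀ i, Continuous fun p : E d × 𝒵 => Q.Γ i p.1 p.2) ∧
  (∀ i, Continuous fun p : E d × 𝒵 => Q.K i p.1 p.2) ∧
  (∀ (i : Fin M) (x : E d), ∀ ε > (0 : ℝ), ∃ δ > (0 : ℝ), ∀ y, dist y x < δ →
      Metric.hausdorffDist (Q.Z i x) (Q.Z i y) < ε) ∧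
  ∀ i x, ∀ z ∈ Q.Z i x, κ₀ ≤ Q.K i x z

/-- Assumption (H.3): `λ₀ > sup_{i,α} ([σ^α_i]₁² + [b^α_i]₁)`. -/
def H3 (P : HJBData d d' M 𝒜) (lam0 : ℝ) : Prop :=
  ∃ Kσ Kb : ℝ, 0 ≤ Kσ ∧ 0 ≤ Kb ∧ Kσ ^ 2 + Kb < lam0 ∧
    ∀ i, ∀ α ∈ P.A i,
      (∀ x y, frobNorm (P.σm i α x - P.σm i α y) ≤ Kσ * ‖x - y‖) ∧
      ∀ x y, ‖P.bv i α x - P.bv i α y‖ ≤ Kb * ‖x - y‖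

/-- Assumption (H.4): the intervention operator preserves Lipschitz functions,
`[M_i u]₁ ≤ sup_j [u_j]₁ + C`. -/
def H4 (Q : ImpulseData d M 𝒵) (C : ℝ) : Prop :=
  0 ≤ C ∧ ∀ u : Fin M → E d → ℝ, (∀ i, InC01 (u i)) →
    ∀ L : ℝ, 0 ≤ L → (∀ i x y, |u i x - u i y| ≤ L * ‖x - y‖) →
      ∀ i x y, |Q.Mop i u x - Q.Mop i u y| ≤ (L + C) * ‖x - y‖

/-- `C¹` regularity with bounded and Lipschitz derivative. -/
def C1Bound {F : Type} [NormedAddCommGroup F] [NormedSpace ℝ F] (f : E d → F) (C : ℝ) : Prop :=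
  ContDiff ℝ 1 f ∧ (∀ x, ‖fderiv ℝ f x‖ ≤ C) ∧
    ∀ x y, ‖fderiv ℝ f x - fderiv ℝ f y‖ ≤ C * ‖x - y‖

/-- Assumption (H.5). -/
def H5 (P : HJBData d d' M 𝒜) (C : ℝ) : Prop :=
  ∀ i, ∀ α ∈ P.A i,
    (∀ k l, C1Bound (fun x => P.σm i α x k l) C) ∧
    C1Bound (P.bv i α) C ∧ C1Bound (P.cz i α) C ∧
    (∀ j, C1Bound (P.dcp i j α) C) ∧
    Semiconcave (P.runCost i α) C

/-- Assumption (H.6): the intervention operator preserves semiconcave functions,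
`[M_i u]_{2,+} ≤ sup_j [u_j]_{2,+} + C`. -/
def H6 (Q : ImpulseData d M 𝒵) (C : ℝ) : Prop :=
  0 ≤ C ∧ ∀ u : Fin M → E d → ℝ, (∀ i, Continuous (u i)) → (∃ B, ∀ i x, |u i x| ≤ B) →
    ∀ Cu : ℝ, 0 ≤ Cu → (∀ i, Semiconcave (u i) Cu) →
      ∀ i, Semiconcave (fun x => Q.Mop i u x) (Cu + C)

/-- Switching intervention operator `(M_i u)(x) = min_{j ≠ i} [u_j(x) + k_{ij}(x)]`. -/
def Msw (k : Fin M → Fin M → E d → ℝ) (i : Fin M) (u : Fin M → E d → ℝ) (x : E d) : ℝ :=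
  sInf ((fun j => u j x + k i j x) '' {j | j ≠ i})

/-- The switching HJBQVI operator. -/
def Fsw (P : HJBData d d' M 𝒜) (k : Fin M → Fin M → E d → ℝ) : Op d M :=
  fun i x u p X => max (P.Ham i x (fun j => u j x) p X) (u i x - Msw k i u x)

/-- The componentwise penalized switching system operator. -/
def FswPen (P : HJBData d d' M 𝒜) (k : Fin M → Fin M → E d → ℝ) (ρ : ℝ) : Op d M :=
  fun i x u p X => P.Ham i x (fun j => u j x) p X
    + ρ * ∑ j ∈ Finset.univ.erase i, max (u i x - u j x - k i j x) 0

/-- Assumption (H.7) on signed switching costs. -/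
def H7 (k : Fin M → Fin M → E d → ℝ) (κ₀ C : ℝ) : Prop :=
  0 < κ₀ ∧ 0 ≤ C ∧
  (∀ i x, k i i x = 0) ∧
  (∀ i j l, j ≠ i → ∀ x : E d, κ₀ ≤ k i j x + k j l x - k i l x) ∧
  (∀ i j, (∀ x, |k i j x| ≤ C) ∧ ∀ x y, |k i j x - k i j y| ≤ C * ‖x - y‖) ∧
  ∀ i j (x : E d), k i j x < κ₀ → ∃ h₀ > (0 : ℝ), ∀ h : E d, ‖h‖ < h₀ →
    k i j (x + h) - 2 * k i j x + k i j (x - h) ≤ C * ‖h‖ ^ 2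

/-- `k̃_i = min{min_{j≠i}(k_{ji} − ε), 0}`. -/
def ktil (k : Fin M → Fin M → E d → ℝ) (ε : ℝ) (i : Fin M) (x : E d) : ℝ :=
  sInf (insert 0 ((fun j => k j i x - ε) '' {j | j ≠ i}))

/-- Strict viscosity subsolution with margin `g`: `F_i(x, u, Dφ, D²φ) ≤ g` at
every local maximum of `u_i − φ`. -/
def IsStrictSubsolution (F : Op d M) (g : ℝ) (u : Fin M → E d → ℝ) : Prop :=
  (∀ i, UpperSemicontinuous (u i)) ∧
  ∀ (i : Fin M) (φ : E d → ℝ), ContDiff ℝ 2 φ → ∀ x : E d,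
    IsLocalMax (fun y => u i y - φ y) x → F i x u (gradient φ x) (hess φ x) ≤ g

/-- Half-relaxed upper limit `u*(x) = limsup_{ρ→∞, y→x} u^ρ(y)`. -/
def relaxSup (u : ℕ → E d → ℝ) (x : E d) : ℝ :=
  Filter.limsup (fun p : ℕ × E d => u p.1 p.2) (Filter.atTop ×ˢ nhds x)

/-- Half-relaxed lower limit `u_*(x) = liminf_{ρ→∞, y→x} u^ρ(y)`. -/
def relaxInf (u : ℕ → E d → ℝ) (x : E d) : ℝ :=
  Filter.liminf (fun p : ℕ × E d => u p.1 p.2) (Filter.atTop ×ˢ nhds x)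

/-- Set of optimal impulse controls `𝒵^v_i(x)`. -/
def argminSet (Q : ImpulseData d M 𝒵) (v : Fin M → E d → ℝ) (i : Fin M) (x : E d) : Set 𝒵 :=
  {z | z ∈ Q.Z i x ∧ ∀ z' ∈ Q.Z i x,
    v i (Q.Γ i x z) + Q.K i x z ≤ v i (Q.Γ i x z') + Q.K i x z'}

section Regularization

variable {F : Type*} [NormedAddCommGroup F]

/-- Sup-convolution `ξ ↦ sup_x (u x - μ/4 |x - ξ|²)`. -/
def supConv (μ : ℝ) (u : F → ℝ) (ξ : F) : ℝ := ⨆ x, (u x - μ / 4 * ‖x - ξ‖ ^ 2)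

/-- Lasry–Lions regularization: the inf-convolution of the sup-convolution. -/
def lasryLions (μ : ℝ) (u : F → ℝ) (q : F) : ℝ := ⨅ ξ, (supConv μ u ξ + μ / 2 * ‖ξ - q‖ ^ 2)

variable {μ B : ℝ} {u : F → ℝ}

lemma bddAbove_supConv (hμ : 0 < μ) (hu : ∀ x, |u x| ≤ B) (ξ : F) :
    BddAbove (Set.range fun x => u x - μ / 4 * ‖x - ξ‖ ^ 2) := by
  refine ⟨B, ?_⟩
  rintro _ ⟨x, rfl⟩
  have := (abs_le.1 (hu x)).2
  have : 0 ≤ μ / 4 * ‖x - ξ‖ ^ 2 := by positivity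
  dsimp only
  linarith

lemma le_supConv (hμ : 0 < μ) (hu : ∀ x, |u x| ≤ B) (x ξ : F) :
    u x - μ / 4 * ‖x - ξ‖ ^ 2 ≤ supConv μ u ξ :=
  le_ciSup (bddAbove_supConv hμ hu ξ) x

lemma supConv_le (hμ : 0 < μ) (hu : ∀ x, |u x| ≤ B) (ξ : F) : supConv μ u ξ ≤ B := by
  refine ciSup_le fun x => ?_
  have := (abs_le.1 (hu x)).2
  have : 0 ≤ μ / 4 * ‖x - ξ‖ ^ 2 := by positivity
  linarith

lemma neg_le_supConv (hμ : 0 < μ) (hu : ∀ x, |u x| ≤ B) (ξ : F) : -B ≤ supConv μ u ξ := by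
  have h := le_supConv hμ hu ξ ξ
  have := (abs_le.1 (hu ξ)).1
  simp at h
  linarith

lemma bddBelow_lasryLions (hμ : 0 < μ) (hu : ∀ x, |u x| ≤ B) (q : F) :
    BddBelow (Set.range fun ξ => supConv μ u ξ + μ / 2 * ‖ξ - q‖ ^ 2) := by
  refine ⟨-B, ?_⟩
  rintro _ ⟨x, rfl⟩
  have := neg_le_supConv hμ hu x
  have : 0 ≤ μ / 2 * ‖x - q‖ ^ 2 := by positivity
  dsimp only
  linarith

lemma lasryLions_le (hμ : 0 < μ) (hu : ∀ x, |u x| ≤ B) (ξ q : F) :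
    lasryLions μ u q ≤ supConv μ u ξ + μ / 2 * ‖ξ - q‖ ^ 2 :=
  ciInf_le (bddBelow_lasryLions hμ hu q) ξ

variable [InnerProductSpace ℝ F]

lemma le_lasryLions (hμ : 0 < μ) (hu : ∀ x, |u x| ≤ B) (x q : F) :
    u x - μ / 2 * ‖x - q‖ ^ 2 ≤ lasryLions μ u q := by
  refine le_ciInf fun ξ => ?_
  have h := le_supConv hμ hu x ξ
  have h2 : ‖x - ξ‖ ^ 2 ≤ 2 * ‖x - q‖ ^ 2 + 2 * ‖ξ - q‖ ^ 2 := by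
    have e : x - ξ = (x - q) - (ξ - q) := by abel
    have := parallelogram_law_with_norm ℝ (x - q) (ξ - q)
    rw [e]
    nlinarith [sq_nonneg ‖x - q + (ξ - q)‖]
  nlinarith

/-- The Lasry–Lions regularization stays below any paraboloid of opening at most `μ`
that dominates the sup-convolution of `u` of parameter `1 / μ`. -/
lemma lasryLions_le_of_paraboloid (hμ : 0 < μ) (hu : ∀ x, |u x| ≤ B) {β c : ℝ} (hβ : β ≤ μ)
    {a q : F}
    (h : ∀ x ξ, u x - μ / 2 * ‖x - ξ‖ ^ 2 ≤ c + ⟪a, ξ - q⟫ + β / 2 * ‖ξ - q‖ ^ 2) :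
    lasryLions μ u q ≤ c := by
  refine (lasryLions_le hμ hu (q - (1 / μ) • a) q).trans ?_
  have key : supConv μ u (q - (1 / μ) • a) ≤ c - μ / 2 * ‖(1 / μ) • a‖ ^ 2 := by
    refine ciSup_le fun x => ?_
    obtain ⟨b, rfl⟩ : ∃ b, a = μ • b := ⟨(1 / μ) • a, by simp [smul_smul, hμ.ne']⟩
    obtain ⟨X, rfl⟩ : ∃ X, x = q + X := ⟨x - q, by abel⟩
    have h1 := h (q + X) (q + (1 / 2 : ℝ) • (X - b))
    have e1 : q + X - (q + (1 / 2 : ℝ) • (X - b)) = (1 / 2 : ℝ) • (X + b) := by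
      module
    have e2 : q + (1 / 2 : ℝ) • (X - b) - q = (1 / 2 : ℝ) • (X - b) := by abel
    have e3 : (1 / μ) • μ • b = b := by simp [smul_smul, hμ.ne']
    have e4 : q + X - (q - b) = X + b := by abel
    rw [e1, e2] at h1
    rw [e3, e4]
    have h2 : β / 2 * ‖(1 / 2 : ℝ) • (X - b)‖ ^ 2 ≤ μ / 2 * ‖(1 / 2 : ℝ) • (X - b)‖ ^ 2 := by
      gcongr
    rw [norm_smul, norm_smul, mul_pow, mul_pow, real_inner_smul_left, real_inner_smul_right] at *
    simp only [← real_inner_self_eq_norm_sq, inner_sub_left, inner_sub_right, inner_add_left,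
      inner_add_right, real_inner_comm X b] at *
    norm_num at *
    nlinarith
  have e : q - (1 / μ) • a - q = -((1 / μ) • a) := by abel
  rw [e, norm_neg]
  linarith

lemma supConv_semiconvex (hμ : 0 < μ) (hu : ∀ x, |u x| ≤ B) (ξ ζ : F) {t : ℝ} (h0 : 0 ≤ t)
    (h1 : t ≤ 1) :
    supConv μ u (ξ + t • ζ) ≤ (1 - t) * supConv μ u ξ + t * supConv μ u (ξ + ζ)
      + t * (1 - t) * (μ / 4 * ‖ζ‖ ^ 2) := by
  refine ciSup_le fun x => ?_
  have i1 := mul_le_mul_of_nonneg_left (le_supConv hμ hu x ξ) (sub_nonneg.2 h1)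
  have i2 := mul_le_mul_of_nonneg_left (le_supConv hμ hu x (ξ + ζ)) h0
  have e1 : x - (ξ + t • ζ) = (x - ξ) - t • ζ := by abel
  have e2 : x - (ξ + ζ) = (x - ξ) - ζ := by abel
  rw [e1, norm_sub_sq_real, norm_smul, real_inner_smul_right, mul_pow, Real.norm_eq_abs, sq_abs]
  rw [e2, norm_sub_sq_real] at i2
  nlinarith

variable [FiniteDimensional ℝ F]

lemma exists_lasryLions_eq (hμ : 0 < μ) (hu : ∀ x, |u x| ≤ B) (q : F) :
    ∃ ξ, ∀ ζ, supConv μ u ξ + μ / 2 * ‖ξ - q‖ ^ 2 ≤ supConv μ u ζ + μ / 2 * ‖ζ - q‖ ^ 2 := by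
  have hlsc : LowerSemicontinuous fun ξ => supConv μ u ξ + μ / 2 * ‖ξ - q‖ ^ 2 := by
    refine LowerSemicontinuous.add ?_ (Continuous.lowerSemicontinuous (by fun_prop))
    exact lowerSemicontinuous_ciSup (fun ξ => bddAbove_supConv hμ hu ξ)
      fun x => Continuous.lowerSemicontinuous (by fun_prop)
  have hB : 0 ≤ B := (abs_nonneg _).trans (hu q)
  set R : ℝ := 1 + 4 * B / μ with hR
  have hR1 : 1 ≤ R := by rw [hR]; have : 0 ≤ 4 * B / μ := by positivity
                         linarith
  have hRμ : μ * R = μ + 4 * B := by rw [hR]; field_simp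
  obtain ⟨ξ, -, hξ⟩ := (hlsc.lowerSemicontinuousOn (Metric.closedBall q R)).exists_isMinOn
    ⟨q, Metric.mem_closedBall_self (by linarith)⟩ (isCompact_closedBall q R)
  refine ⟨ξ, fun ζ => ?_⟩
  by_cases hζ : ζ ∈ Metric.closedBall q R
  · exact hξ hζ
  · have hq : supConv μ u ξ + μ / 2 * ‖ξ - q‖ ^ 2 ≤ supConv μ u q + μ / 2 * ‖q - q‖ ^ 2 :=
      hξ (Metric.mem_closedBall_self (by linarith))
    have h1 := supConv_le hμ hu q
    have h2 := neg_le_supConv hμ hu ζ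
    rw [Metric.mem_closedBall, not_le, dist_eq_norm] at hζ
    have h3 : μ * R ≤ μ * ‖ζ - q‖ ^ 2 := by gcongr; nlinarith
    simp at hq
    linarith

/-- The Lasry–Lions regularization is trapped between two paraboloids at every point. -/
lemma exists_paraboloids_lasryLions (hμ : 0 < μ) (hu : ∀ x, |u x| ≤ B) (q : F) :
    ∃ p : F, ∀ w, |lasryLions μ u w - lasryLions μ u q - ⟪p, w - q⟫| ≤ μ / 2 * ‖w - q‖ ^ 2 := by
  obtain ⟨ξ, hξ⟩ := exists_lasryLions_eq hμ hu q
  have hq : lasryLions μ u q = supConv μ u ξ + μ / 2 * ‖ξ - q‖ ^ 2 :=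
    le_antisymm (lasryLions_le hμ hu ξ q) (le_ciInf hξ)
  have hsub : ∀ ζ, supConv μ u ξ + μ * ⟪q - ξ, ζ⟫ - μ / 4 * ‖ζ‖ ^ 2 ≤ supConv μ u (ξ + ζ) := by
    intro ζ
    have hlim : Tendsto (fun t : ℝ => supConv μ u (ξ + ζ) - supConv μ u ξ - μ * ⟪q - ξ, ζ⟫
        + μ / 2 * t * ‖ζ‖ ^ 2 + (1 - t) * (μ / 4 * ‖ζ‖ ^ 2)) (𝓝[>] 0)
        (𝓝 (supConv μ u (ξ + ζ) - supConv μ u ξ - μ * ⟪q - ξ, ζ⟫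
        + μ / 2 * 0 * ‖ζ‖ ^ 2 + (1 - 0) * (μ / 4 * ‖ζ‖ ^ 2))) :=
      (Continuous.tendsto (by fun_prop) 0).mono_left nhdsWithin_le_nhds
    have := ge_of_tendsto hlim (b := 0) (by
      filter_upwards [Ioc_mem_nhdsGT (show (0 : ℝ) < 1 by norm_num)] with t ht
      have h1 := supConv_semiconvex hμ hu ξ ζ ht.1.le ht.2
      have h2 := hξ (ξ + t • ζ)
      have e : ξ + t • ζ - q = t • ζ - (q - ξ) := by abel
      have e' : ξ - q = - (q - ξ) := by abel
      rw [e, e', norm_neg, norm_sub_sq_real (t • ζ), norm_smul, real_inner_smul_left, mul_pow,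
        Real.norm_eq_abs, sq_abs, real_inner_comm] at h2
      refine nonneg_of_mul_nonneg_right (a := t) ?_ ht.1
      nlinarith)
    linarith
  refine ⟨μ • (q - ξ), fun w => ?_⟩
  obtain ⟨k, rfl⟩ : ∃ k, w = q + k := ⟨w - q, by abel⟩
  rw [add_sub_cancel_left, real_inner_smul_left, abs_le]
  constructor
  · suffices h : lasryLions μ u q + μ * ⟪q - ξ, k⟫ - μ / 2 * ‖k‖ ^ 2 ≤ lasryLions μ u (q + k) by
      linarith
    refine le_ciInf fun z => ?_
    obtain ⟨ζ, rfl⟩ : ∃ ζ, z = ξ + ζ := ⟨z - ξ, by abel⟩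
    have h1 := hsub ζ
    have e1 : ξ - q = - (q - ξ) := by abel
    have e2 : ξ + ζ - (q + k) = (ζ - k) - (q - ξ) := by abel
    rw [hq, e1, e2, norm_neg, norm_sub_sq_real (ζ - k), norm_sub_sq_real ζ, inner_sub_left ζ,
      real_inner_comm (q - ξ) ζ, real_inner_comm (q - ξ) k]
    have h3 := sq_nonneg ‖ζ - (2 : ℝ) • k‖
    have h3' : 0 ≤ μ / 4 * ‖ζ - (2 : ℝ) • k‖ ^ 2 := by positivity
    rw [norm_sub_sq_real, norm_smul, real_inner_smul_right] at h3'
    norm_num at h3'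
    nlinarith
  · have h1 := lasryLions_le hμ hu ξ (q + k)
    have e1 : ξ - q = - (q - ξ) := by abel
    have e2 : ξ - (q + k) = -((q - ξ) + k) := by abel
    rw [e2, norm_neg, norm_add_sq_real] at h1
    rw [hq, e1, norm_neg]
    linarith

end Regularization

section Gradient

variable {F : Type*} [NormedAddCommGroup F] [InnerProductSpace ℝ F] {h : F → ℝ} {P : F → F} {μ : ℝ}

lemma norm_sub_le_of_paraboloids
    (hP : ∀ q w, |h w - h q - ⟪P q, w - q⟫| ≤ μ / 2 * ‖w - q‖ ^ 2) (x y : F) :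
    ‖P x - P y‖ ≤ 3 * μ * ‖x - y‖ := by
  rcases eq_or_ne (P x) (P y) with hxy | hxy
  · rcases eq_or_ne x y with rfl | hne
    · simp
    have h1 := (abs_nonneg _).trans (hP x y)
    have h2 : 0 < ‖y - x‖ := norm_pos_iff.2 (sub_ne_zero.2 hne.symm)
    have h3 : 0 ≤ μ := by
      by_contra! hneg
      nlinarith [pow_pos h2 2]
    rw [hxy, sub_self, norm_zero]
    positivity
  have hD : 0 < ‖P x - P y‖ := norm_pos_iff.2 (sub_ne_zero.2 hxy)
  have hne : x ≠ y := by rintro rfl; exact hxy rfl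
  have ht : 0 < ‖x - y‖ := norm_pos_iff.2 (sub_ne_zero.2 hne)
  set t := ‖x - y‖
  set e : F := (t / ‖P x - P y‖) • (P x - P y) with he
  have hen : ‖e‖ = t := by
    rw [he, norm_smul, Real.norm_of_nonneg (by positivity)]
    field_simp
  have hDe : ⟪P x - P y, e⟫ = t * ‖P x - P y‖ := by
    rw [he, real_inner_smul_right, real_inner_self_eq_norm_sq]
    field_simp
  have hμ : 0 ≤ μ := by
    have h1 := (abs_nonneg _).trans (hP y x)
    by_contra! hneg
    nlinarith [pow_pos ht 2]
  have h1 := (abs_le.1 (hP y (x + e))).2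
  have h2 := (abs_le.1 (hP x (x + e))).1
  have h3 := (abs_le.1 (hP y x)).1
  have e1 : x + e - y = (x - y) + e := by abel
  have e2 : x + e - x = e := by abel
  rw [e1, inner_add_right] at h1
  rw [e2, hen] at h2
  have h4 : ‖(x - y) + e‖ ^ 2 ≤ (2 * t) ^ 2 := by
    have := norm_add_le (x - y) e
    gcongr
    linarith
  have h5 : μ / 2 * ‖(x - y) + e‖ ^ 2 ≤ μ / 2 * (2 * t) ^ 2 := by gcongr
  rw [inner_sub_left] at hDe
  have h6 : t * ‖P x - P y‖ ≤ t * (3 * μ * t) := by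
    have h3' : h x - h y - ⟪P y, x - y⟫ ≥ - (μ / 2 * t ^ 2) := h3
    nlinarith
  exact le_of_mul_le_mul_left h6 ht

lemma hasFDerivAt_of_paraboloids
    (hP : ∀ q w, |h w - h q - ⟪P q, w - q⟫| ≤ μ / 2 * ‖w - q‖ ^ 2) (q : F) :
    HasFDerivAt h (innerSL ℝ (P q)) q := by
  refine HasFDerivAt.of_isLittleO ?_
  refine Asymptotics.IsBigO.trans_isLittleO (g := fun w => ‖w - q‖ ^ 2) ?_ ?_
  · refine Asymptotics.IsBigO.of_bound (μ / 2) (Eventually.of_forall fun w => ?_)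
    simpa using hP q w
  · have := (Asymptotics.isLittleO_norm_pow_id (E' := F) one_lt_two).comp_tendsto
      (show Tendsto (fun w => w - q) (𝓝 q) (𝓝 0) by
        simpa using (continuous_id.sub continuous_const).tendsto (f := fun w : F => w - q) q)
    exact this

lemma second_order_expansion
    (hP : ∀ q w, |h w - h q - ⟪P q, w - q⟫| ≤ μ / 2 * ‖w - q‖ ^ 2) {q : F} {D : F →L[ℝ] F}
    (hD : HasFDerivAt P D q) {ε : ℝ} (hε : 0 < ε) :
    ∀ᶠ k in 𝓝 (0 : F), |h (q + k) - h q - ⟪P q, k⟫ - 1 / 2 * ⟪D k, k⟫| ≤ ε * ‖k‖ ^ 2 := by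
  have h1 := (hasFDerivAt_iff_isLittleO_nhds_zero.1 hD).bound hε
  obtain ⟨r, hr, hball⟩ := Metric.eventually_nhds_iff_ball.1 h1
  refine Metric.eventually_nhds_iff_ball.2 ⟨r, hr, fun k hk => ?_⟩
  have hderiv : ∀ t : ℝ, HasDerivAt
      (fun t : ℝ => h (q + t • k) - h q - t * ⟪P q, k⟫ - t ^ 2 / 2 * ⟪D k, k⟫)
      (⟪P (q + t • k), k⟫ - ⟪P q, k⟫ - t * ⟪D k, k⟫) t := by
    intro t
    have a1 : HasDerivAt (fun t : ℝ => q + t • k) k t := by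
      simpa using ((hasDerivAt_id t).smul_const k).const_add q
    have a2 : HasDerivAt (fun t : ℝ => h (q + t • k)) (⟪P (q + t • k), k⟫) t := by
      exact (hasFDerivAt_of_paraboloids hP (q + t • k)).comp_hasDerivAt t a1
    have a3 : HasDerivAt (fun t : ℝ => t * ⟪P q, k⟫) (⟪P q, k⟫) t := by
      simpa using (hasDerivAt_id t).mul_const (⟪P q, k⟫)
    have a4 : HasDerivAt (fun t : ℝ => t ^ 2 / 2 * ⟪D k, k⟫) (t * ⟪D k, k⟫) t := by
      have := ((hasDerivAt_pow 2 t).div_const 2).mul_const (⟪D k, k⟫)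
      simpa using this
    exact ((a2.sub_const (h q)).sub a3).sub a4
  have hbound : ∀ t ∈ Set.Ico (0 : ℝ) 1,
      ‖⟪P (q + t • k), k⟫ - ⟪P q, k⟫ - t * ⟪D k, k⟫‖ ≤ ε * ‖k‖ ^ 2 := by
    intro t ht
    have b1 : t • k ∈ Metric.ball (0 : F) r := by
      rw [mem_ball_zero_iff] at hk ⊢
      rw [norm_smul, Real.norm_of_nonneg ht.1]
      nlinarith [norm_nonneg k, ht.2]
    have b2 := hball _ b1
    have b3 : ⟪P (q + t • k), k⟫ - ⟪P q, k⟫ - t * ⟪D k, k⟫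
        = ⟪P (q + t • k) - P q - D (t • k), k⟫ := by
      rw [inner_sub_left, inner_sub_left, map_smul, real_inner_smul_left]
    rw [b3]
    refine (norm_inner_le_norm _ _).trans ?_
    rw [norm_smul, Real.norm_of_nonneg ht.1] at b2
    have b4 : ε * (t * ‖k‖) ≤ ε * (1 * ‖k‖) := by gcongr; exact ht.2.le
    nlinarith [norm_nonneg k]
  have := norm_image_sub_le_of_norm_deriv_le_segment_01'
    (fun t _ => (hderiv t).hasDerivWithinAt) hbound
  simpa using this

lemma eq_zero_of_inner_le {g : F} {C : ℝ} (hg : ∀ v, ⟪g, v⟫ ≤ C * ‖v‖ ^ 2) : g = 0 := by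
  by_contra hne
  have hpos : 0 < ‖g‖ ^ 2 := by positivity
  have h1 := hg ((1 / (|C| + 1)) • g)
  have hC : 0 < |C| + 1 := by positivity
  rw [real_inner_smul_right, real_inner_self_eq_norm_sq, norm_smul, mul_pow,
    Real.norm_of_nonneg (by positivity)] at h1
  have h2 : C * ((1 / (|C| + 1)) ^ 2 * ‖g‖ ^ 2) ≤ |C| * ((1 / (|C| + 1)) ^ 2 * ‖g‖ ^ 2) := by
    gcongr; exact le_abs_self C
  have h3 := h1.trans h2
  rw [← mul_assoc] at h3
  have h4 := le_of_mul_le_mul_right h3 hpos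
  field_simp at h4
  linarith

variable {k : F → ℝ} {S : F → F} {α δ : ℝ} {p₁ p₂ ξ η : F}

lemma first_order_condition
    (hP : ∀ q w, |h w - h q - ⟪P q, w - q⟫| ≤ μ / 2 * ‖w - q‖ ^ 2)
    (hS : ∀ q w, |k w - k q - ⟪S q, w - q⟫| ≤ μ / 2 * ‖w - q‖ ^ 2)
    (hmax : ∀ ξ' η', h ξ' - k η' - α / 2 * ‖ξ' - η'‖ ^ 2 - δ * ‖ξ'‖ ^ 2 - ⟪p₁, ξ'⟫ - ⟪p₂, η'⟫
      ≤ h ξ - k η - α / 2 * ‖ξ - η‖ ^ 2 - δ * ‖ξ‖ ^ 2 - ⟪p₁, ξ⟫ - ⟪p₂, η⟫) :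
    P ξ = α • (ξ - η) + (2 * δ) • ξ + p₁ ∧ S η = α • (ξ - η) - p₂ := by
  constructor
  · refine sub_eq_zero.1 (eq_zero_of_inner_le (C := μ / 2 + α / 2 + δ) fun v => ?_)
    have h1 := hmax (ξ + v) η
    have h2 := (abs_le.1 (hP ξ (ξ + v))).1
    have e1 : ξ + v - η = (ξ - η) + v := by abel
    have e2 : ξ + v - ξ = v := by abel
    rw [e1, norm_add_sq_real, norm_add_sq_real, inner_add_right] at h1
    rw [e2] at h2
    rw [inner_sub_left, inner_add_left, inner_add_left, real_inner_smul_left,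
      real_inner_smul_left]
    linarith
  · refine sub_eq_zero.1 (neg_eq_zero.1 (eq_zero_of_inner_le (C := μ / 2 + α / 2) fun v => ?_))
    have h1 := hmax ξ (η + v)
    have h2 := (abs_le.1 (hS η (η + v))).2
    have e1 : ξ - (η + v) = (ξ - η) - v := by abel
    have e2 : η + v - η = v := by abel
    rw [e1, norm_sub_sq_real (ξ - η), inner_add_right p₂] at h1
    rw [e2] at h2
    rw [inner_neg_left, inner_sub_left, inner_sub_left, real_inner_smul_left]
    linarith

lemma second_order_condition
    (hP : ∀ q w, |h w - h q - ⟪P q, w - q⟫| ≤ μ / 2 * ‖w - q‖ ^ 2)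
    (hS : ∀ q w, |k w - k q - ⟪S q, w - q⟫| ≤ μ / 2 * ‖w - q‖ ^ 2)
    (hmax : ∀ ξ' η', h ξ' - k η' - α / 2 * ‖ξ' - η'‖ ^ 2 - δ * ‖ξ'‖ ^ 2 - ⟪p₁, ξ'⟫ - ⟪p₂, η'⟫
      ≤ h ξ - k η - α / 2 * ‖ξ - η‖ ^ 2 - δ * ‖ξ‖ ^ 2 - ⟪p₁, ξ⟫ - ⟪p₂, η⟫)
    {D T : F →L[ℝ] F} (hD : HasFDerivAt P D ξ) (hT : HasFDerivAt S T η) (v v' : F) :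
    ⟪D v, v⟫ - ⟪T v', v'⟫ ≤ α * ‖v - v'‖ ^ 2 + 2 * δ * ‖v‖ ^ 2 := by
  obtain ⟨f1, f2⟩ := first_order_condition hP hS hmax
  refine le_of_forall_pos_le_add fun ε hε => ?_
  set c : ℝ := ε / (2 * (‖v‖ ^ 2 + ‖v'‖ ^ 2 + 1))
  have hc : 0 < c := by positivity
  have hcε : 2 * c * (‖v‖ ^ 2 + ‖v'‖ ^ 2) ≤ ε := by
    have : 2 * c * (‖v‖ ^ 2 + ‖v'‖ ^ 2 + 1) = ε := by simp only [c]; field_simp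
    linarith
  have t1 : Tendsto (fun t : ℝ => t • v) (𝓝[>] 0) (𝓝 0) := by
    have : Tendsto (fun t : ℝ => t • v) (𝓝 0) (𝓝 ((0 : ℝ) • v)) :=
      Continuous.tendsto (by fun_prop) 0
    rw [zero_smul] at this
    exact this.mono_left nhdsWithin_le_nhds
  have t2 : Tendsto (fun t : ℝ => t • v') (𝓝[>] 0) (𝓝 0) := by
    have : Tendsto (fun t : ℝ => t • v') (𝓝 0) (𝓝 ((0 : ℝ) • v')) :=
      Continuous.tendsto (by fun_prop) 0
    rw [zero_smul] at this
    exact this.mono_left nhdsWithin_le_nhds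
  obtain ⟨t, ht, h1, h2⟩ := ((eventually_mem_nhdsWithin (a := (0 : ℝ)) (s := Set.Ioi 0)).and
    ((t1.eventually (second_order_expansion hP hD hc)).and
    (t2.eventually (second_order_expansion hS hT hc)))).exists
  have ht0 : 0 < t := ht
  have h3 := hmax (ξ + t • v) (η + t • v')
  have e1 : ξ + t • v - (η + t • v') = (ξ - η) + t • (v - v') := by module
  rw [e1, norm_add_sq_real, norm_add_sq_real, inner_add_right p₁, inner_add_right p₂, norm_smul,
    norm_smul, mul_pow, mul_pow, Real.norm_eq_abs, sq_abs] at h3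
  rw [norm_smul, mul_pow, Real.norm_eq_abs, sq_abs, f1, map_smul, inner_add_left, inner_add_left,
    real_inner_smul_left, real_inner_smul_left, real_inner_smul_left] at h1
  rw [norm_smul, mul_pow, Real.norm_eq_abs, sq_abs, f2, map_smul, inner_sub_left,
    real_inner_smul_left, real_inner_smul_left] at h2
  simp only [real_inner_smul_right, inner_sub_right (ξ - η)] at h1 h2 h3
  have h1' := (abs_le.1 h1).1
  have h2' := (abs_le.1 h2).2
  have h4 : t ^ 2 * (⟪D v, v⟫ - ⟪T v', v'⟫)
      ≤ t ^ 2 * (α * ‖v - v'‖ ^ 2 + 2 * δ * ‖v‖ ^ 2 + 2 * c * (‖v‖ ^ 2 + ‖v'‖ ^ 2)) := by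
    nlinarith
  have h5 := le_of_mul_le_mul_left h4 (by positivity)
  linarith

end Gradient

section NullSets

open MeasureTheory

lemma exists_small_notMem_image {X : Type*} [NormedAddCommGroup X] [NormedSpace ℝ X]
    [FiniteDimensional ℝ X] [MeasurableSpace X] [BorelSpace X] (ν : Measure X)
    [ν.IsAddHaarMeasure] {ι : Type*} [Countable ι] {K : ι → NNReal} {G : ι → X → X}
    (hG : ∀ i, LipschitzWith (K i) (G i)) {N : ι → Set X} (hN : ∀ i, ν (N i) = 0) {r : ℝ}
    (hr : 0 < r) : ∃ p : X, ‖p‖ < r ∧ ∀ i, ∀ z ∈ N i, G i z ≠ p := by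
  set m := Measure.hausdorffMeasure (X := X) (Module.finrank ℝ X)
  have : m.IsAddHaarMeasure := isAddHaarMeasure_hausdorffMeasure
  have h1 : ∀ i, m (N i) = 0 := fun i =>
    Measure.absolutelyContinuous_isAddHaarMeasure m ν (hN i)
  have h2 : ∀ i, m (G i '' N i) = 0 := fun i => by
    have := ((hG i).lipschitzOnWith (s := N i)).hausdorffMeasure_image_le
      (d := Module.finrank ℝ X) (Nat.cast_nonneg _)
    rw [h1 i, mul_zero] at this
    exact le_antisymm this bot_le
  have h3 : m (⋃ i, G i '' N i) = 0 := measure_iUnion_null h2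
  have h4 : 0 < m (Metric.ball 0 r) := Metric.measure_ball_pos m 0 hr
  have h5 : ¬ Metric.ball 0 r ⊆ ⋃ i, G i '' N i := fun hsub =>
    h4.ne' (measure_mono_null hsub h3)
  obtain ⟨p, hp, hp'⟩ := Set.not_subset.1 h5
  refine ⟨p, mem_ball_zero_iff.1 hp, fun i z hz hzp => hp' ?_⟩
  exact Set.mem_iUnion.2 ⟨i, z, hz, hzp⟩

/-- For generic small linear perturbations, critical points of the doubled functional
are points of differentiability of the gradients. -/
lemma exists_generic_perturbation {F : Type*} [NormedAddCommGroup F] [InnerProductSpace ℝ F]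
    [FiniteDimensional ℝ F] {ι : Type*} [Countable ι] {P S : ι → F → F} {L : ℝ}
    (hP : ∀ i x y, ‖P i x - P i y‖ ≤ L * ‖x - y‖) (hS : ∀ i x y, ‖S i x - S i y‖ ≤ L * ‖x - y‖)
    (α δ : ℝ) {r : ℝ} (hr : 0 < r) :
    ∃ p₁ p₂ : F, ‖p₁‖ < r ∧ ‖p₂‖ < r ∧ ∀ i ξ η, P i ξ = α • (ξ - η) + δ • ξ + p₁ →
      S i η = α • (ξ - η) - p₂ → DifferentiableAt ℝ (P i) ξ ∧ DifferentiableAt ℝ (S i) η := by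
  borelize F
  have hPL : ∀ i, LipschitzWith (Real.toNNReal L) (P i) := fun i =>
    LipschitzWith.of_dist_le' fun x y => by simpa [dist_eq_norm] using hP i x y
  have hSL : ∀ i, LipschitzWith (Real.toNNReal L) (S i) := fun i =>
    LipschitzWith.of_dist_le' fun x y => by simpa [dist_eq_norm] using hS i x y
  let ν : Measure F := Measure.addHaar
  let G : ι → F × F → F × F := fun i z =>
    (P i z.1 - (α • (z.1 - z.2) + δ • z.1), α • (z.1 - z.2) - S i z.2)
  have hGL : ∀ i, ∃ K, LipschitzWith K (G i) := fun i => by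
    let A : F × F →L[ℝ] F := α • (ContinuousLinearMap.fst ℝ F F - ContinuousLinearMap.snd ℝ F F)
      + δ • ContinuousLinearMap.fst ℝ F F
    let A' : F × F →L[ℝ] F := α • (ContinuousLinearMap.fst ℝ F F - ContinuousLinearMap.snd ℝ F F)
    exact ⟨_, (((hPL i).comp LipschitzWith.prod_fst).sub A.lipschitz).prodMk
      (A'.lipschitz.sub ((hSL i).comp LipschitzWith.prod_snd))⟩
  choose K hK using hGL
  let N : ι → Set (F × F) := fun i =>
    {z | ¬ (DifferentiableAt ℝ (P i) z.1 ∧ DifferentiableAt ℝ (S i) z.2)}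
  have hN : ∀ i, (ν.prod ν) (N i) = 0 := fun i => by
    have a1 : ∀ᵐ z ∂(ν.prod ν), DifferentiableAt ℝ (P i) z.1 :=
      Measure.quasiMeasurePreserving_fst.ae (hPL i).ae_differentiableAt
    have a2 : ∀ᵐ z ∂(ν.prod ν), DifferentiableAt ℝ (S i) z.2 :=
      Measure.quasiMeasurePreserving_snd.ae (hSL i).ae_differentiableAt
    exact ae_iff.1 (a1.and a2)
  obtain ⟨p, hp, hgen⟩ := exists_small_notMem_image (ν.prod ν) hK hN hr
  refine ⟨p.1, p.2, (norm_fst_le p).trans_lt hp, (norm_snd_le p).trans_lt hp, ?_⟩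
  intro i ξ η h1 h2
  by_contra hcon
  refine hgen i (ξ, η) hcon ?_
  ext1
  · simp only [G]; rw [h1]; abel
  · simp only [G]; rw [h2]; abel

end NullSets

/-- The symmetric matrix of the quadratic form `v ↦ ⟪B v, v⟫`. -/
def formMatrix (B : E d →L[ℝ] E d) : Matrix (Fin d) (Fin d) ℝ :=
  Matrix.of fun i j => 1 / 2 * (⟪B (EuclideanSpace.single i 1), EuclideanSpace.single j 1⟫
    + ⟪B (EuclideanSpace.single j 1), EuclideanSpace.single i 1⟫)

/-- The columns of a matrix, as Euclidean vectors. -/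
def eucCol (A : Matrix (Fin d) (Fin d') ℝ) (l : Fin d') : E d := WithLp.toLp 2 fun k => A k l

lemma eucCol_sub (A A' : Matrix (Fin d) (Fin d') ℝ) (l : Fin d') :
    eucCol (A - A') l = eucCol A l - eucCol A' l := rfl

lemma sum_norm_eucCol_sq (A : Matrix (Fin d) (Fin d') ℝ) :
    ∑ l, ‖eucCol A l‖ ^ 2 = frobNorm A ^ 2 := by
  have h : 0 ≤ ∑ k, ∑ l, A k l ^ 2 := by positivity
  rw [frobNorm, Real.sq_sqrt h, Finset.sum_comm]
  simp [EuclideanSpace.norm_sq_eq, eucCol]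

lemma sum_norm_eucCol_sq_le {A : Matrix (Fin d) (Fin d') ℝ} {R : ℝ} (h : frobNorm A ≤ R) :
    ∑ l, ‖eucCol A l‖ ^ 2 ≤ R ^ 2 := by
  rw [sum_norm_eucCol_sq]
  have : 0 ≤ frobNorm A := Real.sqrt_nonneg _
  gcongr

lemma eucCol_eq_sum (A : Matrix (Fin d) (Fin d') ℝ) (l : Fin d') :
    eucCol A l = ∑ k, A k l • EuclideanSpace.single k (1 : ℝ) := by
  ext j
  simp [eucCol, Finset.sum_apply, Pi.single_apply]

lemma trace_mul_formMatrix (A : Matrix (Fin d) (Fin d') ℝ) (B : E d →L[ℝ] E d) :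
    Matrix.trace (((1 : ℝ) / 2) • (A * Aᵀ) * formMatrix B)
      = 1 / 2 * ∑ l, ⟪B (eucCol A l), eucCol A l⟫ := by
  set b : Fin d → Fin d → ℝ := fun i j =>
    ⟪B (EuclideanSpace.single i 1), EuclideanSpace.single j 1⟫ with hb
  have h1 : ∀ l, ⟪B (eucCol A l), eucCol A l⟫ = ∑ i, ∑ j, A i l * A j l * b i j := by
    intro l
    rw [eucCol_eq_sum, map_sum, sum_inner]
    refine Finset.sum_congr rfl fun i _ => ?_
    rw [inner_sum]
    refine Finset.sum_congr rfl fun j _ => ?_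
    rw [map_smul, real_inner_smul_left, real_inner_smul_right]
    ring
  have h2 : ∑ l, ∑ i, ∑ j, A i l * A j l * b i j = ∑ i, ∑ j, (A * Aᵀ) i j * b i j := by
    rw [Finset.sum_comm]
    refine Finset.sum_congr rfl fun i _ => ?_
    rw [Finset.sum_comm]
    refine Finset.sum_congr rfl fun j _ => ?_
    rw [Matrix.mul_apply, Finset.sum_mul]
    rfl
  have h3 : ∑ i, ∑ j, (A * Aᵀ) i j * b j i = ∑ i, ∑ j, (A * Aᵀ) i j * b i j := by
    rw [Finset.sum_comm]
    refine Finset.sum_congr rfl fun i _ => Finset.sum_congr rfl fun j _ => ?_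
    congr 1
    simp only [Matrix.mul_apply, Matrix.transpose_apply, mul_comm]
  simp_rw [h1]
  rw [h2, smul_mul_assoc, Matrix.trace_smul, smul_eq_mul]
  congr 1
  simp only [Matrix.trace, Matrix.diag, Matrix.mul_apply (M := A * Aᵀ), formMatrix, Matrix.of_apply]
  calc ∑ i, ∑ j, (A * Aᵀ) i j * (1 / 2 * (b j i + b i j))
      = 1 / 2 * (∑ i, ∑ j, (A * Aᵀ) i j * b j i + ∑ i, ∑ j, (A * Aᵀ) i j * b i j) := by
        rw [← Finset.sum_add_distrib, Finset.mul_sum]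
        refine Finset.sum_congr rfl fun i _ => ?_
        rw [← Finset.sum_add_distrib, Finset.mul_sum]
        exact Finset.sum_congr rfl fun j _ => by ring
    _ = ∑ i, ∑ j, (A * Aᵀ) i j * b i j := by rw [h3]; ring

/-- Quadratic test function with gradient `p` and Hessian form `B` at `x`. -/
def quadTest (p : E d) (B : E d →L[ℝ] E d) (x y : E d) : ℝ :=
  ⟪p, y - x⟫ + 1 / 2 * ⟪B (y - x), y - x⟫

lemma contDiff_quadTest (p : E d) (B : E d →L[ℝ] E d) (x : E d) :
    ContDiff ℝ 2 (quadTest p B x) := by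
  unfold quadTest
  have h : ContDiff ℝ 2 fun y : E d => y - x := contDiff_id.sub contDiff_const
  exact (contDiff_const.inner ℝ h).add
    (contDiff_const.mul ((B.contDiff.comp h).inner ℝ h))

lemma exists_fderiv_quadTest (p : E d) (B : E d →L[ℝ] E d) (x : E d) :
    ∃ A : E d →L[ℝ] E d →L[ℝ] ℝ,
      (∀ v w, A v w = 1 / 2 * (⟪B v, w⟫ + ⟪B w, v⟫)) ∧
      ∀ y, HasFDerivAt (quadTest p B x) (innerSL ℝ p + A (y - x)) y := by
  let b : E d →ₗ[ℝ] E d →ₗ[ℝ] ℝ := LinearMap.mk₂ ℝ (fun v w => 1 / 2 * (⟪B v, w⟫ + ⟪B w, v⟫))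
    (fun u v w => by simp only [map_add, inner_add_left, inner_add_right]; ring)
    (fun c v w => by simp only [map_smul, real_inner_smul_left, real_inner_smul_right, smul_eq_mul]
                     ring)
    (fun u v w => by simp only [map_add, inner_add_left, inner_add_right]; ring)
    (fun c v w => by simp only [map_smul, real_inner_smul_left, real_inner_smul_right, smul_eq_mul]
                     ring)
  let A : E d →L[ℝ] E d →L[ℝ] ℝ := LinearMap.mkContinuous₂ b ‖B‖ (fun v w => by
    simp only [b, LinearMap.mk₂_apply, Real.norm_eq_abs]
    have h1 := (abs_real_inner_le_norm (B v) w).trans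
      (mul_le_mul_of_nonneg_right (B.le_opNorm v) (norm_nonneg w))
    have h2 := (abs_real_inner_le_norm (B w) v).trans
      (mul_le_mul_of_nonneg_right (B.le_opNorm w) (norm_nonneg v))
    rw [abs_mul, abs_of_pos (by norm_num : (0 : ℝ) < 1 / 2)]
    have := abs_add_le ⟪B v, w⟫ ⟪B w, v⟫
    nlinarith)
  refine ⟨A, fun v w => rfl, fun y => ?_⟩
  have h : HasFDerivAt (fun y : E d => y - x) (ContinuousLinearMap.id ℝ (E d)) y :=
    (hasFDerivAt_id y).sub_const x
  have h1 : HasFDerivAt (fun y => B (y - x)) (B.comp (ContinuousLinearMap.id ℝ (E d))) y :=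
    B.hasFDerivAt.comp y h
  have h2 := (((innerSL ℝ p).hasFDerivAt.comp y h).add ((h1.inner ℝ h).const_mul (1 / 2)))
  refine HasFDerivAt.congr_fderiv h2 ?_
  ext w
  have : A (y - x) w = 1 / 2 * (⟪B (y - x), w⟫ + ⟪B w, y - x⟫) := rfl
  simp [-map_sub, this, real_inner_comm]

lemma gradient_quadTest (p : E d) (B : E d →L[ℝ] E d) (x : E d) :
    gradient (quadTest p B x) x = p := by
  obtain ⟨A, -, hA⟩ := exists_fderiv_quadTest p B x
  refine HasGradientAt.gradient (hasGradientAt_iff_hasFDerivAt.2 ?_)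
  refine (hA x).congr_fderiv ?_
  ext w
  simp

lemma hess_quadTest (p : E d) (B : E d →L[ℝ] E d) (x : E d) :
    hess (quadTest p B x) x = formMatrix B := by
  obtain ⟨A, hA, hd⟩ := exists_fderiv_quadTest p B x
  have h1 : fderiv ℝ (quadTest p B x) = fun y => innerSL ℝ p + A (y - x) :=
    funext fun y => (hd y).fderiv
  have h2 : HasFDerivAt (fun y => innerSL ℝ p + A (y - x)) A x := by
    have h : HasFDerivAt (fun y : E d => y - x) (ContinuousLinearMap.id ℝ (E d)) x :=
      (hasFDerivAt_id x).sub_const x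
    exact (A.hasFDerivAt.comp x h).const_add _
  ext i j
  simp only [hess, formMatrix, Matrix.of_apply, iteratedFDeriv_two_apply, h1, h2.fderiv, hA]
  simp

lemma quadTest_add_smul_id (p : E d) (B : E d →L[ℝ] E d) (x k : E d) (ε : ℝ) :
    quadTest p (B + (2 * ε) • ContinuousLinearMap.id ℝ (E d)) x (x + k)
      = ⟪p, k⟫ + 1 / 2 * ⟪B k, k⟫ + ε * ‖k‖ ^ 2 := by
  simp only [quadTest, add_sub_cancel_left, _root_.add_apply,
    _root_.smul_apply, ContinuousLinearMap.id_apply, inner_add_left,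
    real_inner_smul_left, real_inner_self_eq_norm_sq]
  ring

lemma quadTest_self (p : E d) (B : E d →L[ℝ] E d) (x : E d) : quadTest p B x x = 0 := by
  simp [quadTest]

lemma tendsto_sub_self_nhds (x : E d) : Tendsto (fun y => y - x) (𝓝 x) (𝓝 0) := by
  have : Tendsto (fun y => y - x) (𝓝 x) (𝓝 (x - x)) := Continuous.tendsto (by fun_prop) x
  rwa [sub_self] at this

lemma IsSubsolution.le_of_superjet {F : Op d M} {u : Fin M → E d → ℝ} (hu : IsSubsolution F u)
    {i : Fin M} {x p : E d} {B : E d →L[ℝ] E d} {ε : ℝ}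
    (hjet : ∀ᶠ k in 𝓝 (0 : E d), u i (x + k) ≤ u i x + ⟪p, k⟫ + 1 / 2 * ⟪B k, k⟫ + ε * ‖k‖ ^ 2) :
    F i x u p (formMatrix (B + (2 * ε) • ContinuousLinearMap.id ℝ (E d))) ≤ 0 := by
  have := hu.2 i _ (contDiff_quadTest p (B + (2 * ε) • ContinuousLinearMap.id ℝ (E d)) x) x (by
    filter_upwards [(tendsto_sub_self_nhds x).eventually hjet] with y hy
    obtain ⟨k, rfl⟩ : ∃ k, y = x + k := ⟨y - x, by abel⟩
    rw [add_sub_cancel_left] at hy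
    rw [quadTest_add_smul_id, quadTest_self]
    linarith)
  rwa [gradient_quadTest, hess_quadTest] at this

lemma IsSupersolution.le_of_subjet {F : Op d M} {u : Fin M → E d → ℝ} (hu : IsSupersolution F u)
    {i : Fin M} {x p : E d} {B : E d →L[ℝ] E d} {ε : ℝ}
    (hjet : ∀ᶠ k in 𝓝 (0 : E d), u i x + ⟪p, k⟫ + 1 / 2 * ⟪B k, k⟫ + ε * ‖k‖ ^ 2 ≤ u i (x + k)) :
    0 ≤ F i x u p (formMatrix (B + (2 * ε) • ContinuousLinearMap.id ℝ (E d))) := by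
  have := hu.2 i _ (contDiff_quadTest p (B + (2 * ε) • ContinuousLinearMap.id ℝ (E d)) x) x (by
    filter_upwards [(tendsto_sub_self_nhds x).eventually hjet] with y hy
    obtain ⟨k, rfl⟩ : ∃ k, y = x + k := ⟨y - x, by abel⟩
    rw [add_sub_cancel_left] at hy
    rw [quadTest_add_smul_id, quadTest_self]
    linarith)
  rwa [gradient_quadTest, hess_quadTest] at this

lemma HJBData.L_formMatrix (P : HJBData d d' M 𝒜) (i : Fin M) (α : 𝒜) (x : E d)
    (s : Fin M → ℝ) (p : E d) (B : E d →L[ℝ] E d) :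
    P.L i α x s p (formMatrix B) = -(1 / 2 * ∑ l, ⟪B (eucCol (P.σm i α x) l),
      eucCol (P.σm i α x) l⟫) - ⟪P.bv i α x, p⟫ + P.cz i α x * s i - P.runCost i α x
      - ∑ j ∈ Finset.univ.erase i, P.dcp i j α x * s j := by
  rw [HJBData.L, trace_mul_formMatrix]

lemma H1.nonneg {P : HJBData d d' M 𝒜} {C lam0 : ℝ} (h1 : H1 P C lam0) (i : Fin M) : 0 ≤ C := by
  obtain ⟨-, hA, h⟩ := h1
  obtain ⟨α, hα⟩ := (hA i).1
  obtain ⟨-, -, -, -, -, -, -, hb, -⟩ := h i α hα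
  exact (norm_nonneg _).trans (hb 0)

lemma H1.bddAbove_L {P : HJBData d d' M 𝒜} {C lam0 : ℝ} (h1 : H1 P C lam0) (i : Fin M) (x : E d)
    (s : Fin M → ℝ) (p : E d) (B : E d →L[ℝ] E d) :
    BddAbove ((fun α => P.L i α x s p (formMatrix B)) '' P.A i) := by
  have hC := h1.nonneg i
  refine ⟨1 / 2 * (‖B‖ * C ^ 2) + C * ‖p‖ + C * |s i| + C
    + ∑ j ∈ Finset.univ.erase i, C * |s j|, ?_⟩
  rintro _ ⟨α, hα, rfl⟩
  obtain ⟨-, -, -, -, -, hσ, -, hb, -, hc, -, hℓ, -, hd, -, -⟩ := h1.2.2 i α hα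
  have e1 : -(∑ l, ⟪B (eucCol (P.σm i α x) l), eucCol (P.σm i α x) l⟫) ≤ ‖B‖ * C ^ 2 := by
    rw [← Finset.sum_neg_distrib]
    refine le_trans ?_ (mul_le_mul_of_nonneg_left (sum_norm_eucCol_sq_le (hσ x)) (norm_nonneg B))
    rw [Finset.mul_sum]
    refine Finset.sum_le_sum fun l _ => ?_
    set v := eucCol (P.σm i α x) l
    have h2 := (abs_real_inner_le_norm (B v) v).trans
      (mul_le_mul_of_nonneg_right (B.le_opNorm v) (norm_nonneg v))
    have h3 := neg_abs_le ⟪B v, v⟫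
    nlinarith
  have e2 : -⟪P.bv i α x, p⟫ ≤ C * ‖p‖ :=
    (neg_le_abs _).trans ((abs_real_inner_le_norm _ _).trans
      (mul_le_mul_of_nonneg_right (hb x) (norm_nonneg p)))
  have e3 : P.cz i α x * s i ≤ C * |s i| :=
    (le_abs_self _).trans ((abs_mul _ _).le.trans
      (mul_le_mul_of_nonneg_right (hc x) (abs_nonneg _)))
  have e4 : -P.runCost i α x ≤ C := (neg_le_abs _).trans (hℓ x)
  have e5 : -∑ j ∈ Finset.univ.erase i, P.dcp i j α x * s j
      ≤ ∑ j ∈ Finset.univ.erase i, C * |s j| := by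
    rw [← Finset.sum_neg_distrib]
    refine Finset.sum_le_sum fun j _ => ?_
    exact (neg_le_abs _).trans ((abs_mul _ _).le.trans
      (mul_le_mul_of_nonneg_right ((hd j).1 x) (abs_nonneg _)))
  dsimp only
  rw [HJBData.L_formMatrix]
  linarith

/-- Structural lower bound for the difference of the linear operators at two points, for Hessian
forms ordered as in the theorem on sums. -/
lemma H1.L_le {P : HJBData d d' M 𝒜} {C lam0 : ℝ} (h1 : H1 P C lam0) {i : Fin M} {α : 𝒜}
    (hα : α ∈ P.A i) {x y : E d} {s t : Fin M → ℝ} {b : ℝ} (hm : 0 ≤ s i - t i)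
    (hst : ∀ j, s j - t j ≤ s i - t i) (ht : ∀ j, |t j| ≤ b) {g e₁ e₂ : E d}
    {B T : E d →L[ℝ] E d} {θ δ ε : ℝ} (hθ : 0 ≤ θ) (hδ : 0 ≤ δ) (hε : 0 ≤ ε)
    (hBT : ∀ v w, ⟪B v, v⟫ - ⟪T w, w⟫ ≤ θ * ‖v - w‖ ^ 2 + 2 * δ * ‖v‖ ^ 2) :
    lam0 * (s i - t i)
      + P.L i α y t (g - e₂) (formMatrix (T + (2 * (-ε)) • ContinuousLinearMap.id ℝ (E d)))
      ≤ P.L i α x s (g + e₁) (formMatrix (B + (2 * ε) • ContinuousLinearMap.id ℝ (E d)))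
        + (1 / 2 * θ * C ^ 2 * ‖x - y‖ ^ 2 + δ * C ^ 2 + C * ‖x - y‖ * ‖g‖
          + C * (‖e₁‖ + ‖e₂‖) + C * ‖x - y‖ * (b + 1 + M * b) + 2 * ε * C ^ 2) := by
  have hC := h1.nonneg i
  have hb0 : 0 ≤ b := (abs_nonneg _).trans (ht i)
  obtain ⟨-, -, -, -, -, hσ, hσL, hb, hbL, -, hcL, -, hℓL, hd, hd0, hlam⟩ := h1.2.2 i α hα
  set r := ‖x - y‖
  have hr : 0 ≤ r := norm_nonneg _
  set V := eucCol (P.σm i α x) with hV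
  set W := eucCol (P.σm i α y) with hW
  have hV2 : ∑ l, ‖V l‖ ^ 2 ≤ C ^ 2 := sum_norm_eucCol_sq_le (hσ x)
  have hW2 : ∑ l, ‖W l‖ ^ 2 ≤ C ^ 2 := sum_norm_eucCol_sq_le (hσ y)
  have hVW : ∑ l, ‖V l - W l‖ ^ 2 ≤ (C * r) ^ 2 := by
    simp_rw [hV, hW, ← eucCol_sub]
    exact sum_norm_eucCol_sq_le (hσL x y)
  have e1 : ∑ l, ⟪B (V l), V l⟫ - ∑ l, ⟪T (W l), W l⟫ ≤ θ * (C * r) ^ 2 + 2 * δ * C ^ 2 := by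
    rw [← Finset.sum_sub_distrib]
    refine (Finset.sum_le_sum fun l _ => hBT (V l) (W l)).trans ?_
    rw [Finset.sum_add_distrib, ← Finset.mul_sum, ← Finset.mul_sum]
    gcongr
  have e2 : ⟪P.bv i α x, g + e₁⟫ - ⟪P.bv i α y, g - e₂⟫ ≤ C * r * ‖g‖ + C * (‖e₁‖ + ‖e₂‖) := by
    have : ⟪P.bv i α x, g + e₁⟫ - ⟪P.bv i α y, g - e₂⟫
        = ⟪P.bv i α x - P.bv i α y, g⟫ + ⟪P.bv i α x, e₁⟫ + ⟪P.bv i α y, e₂⟫ := by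
      simp only [inner_add_right, inner_sub_right, inner_sub_left]; ring
    have k1 := (real_inner_le_norm (P.bv i α x - P.bv i α y) g).trans
      (mul_le_mul_of_nonneg_right (hbL x y) (norm_nonneg g))
    have k2 := (real_inner_le_norm (P.bv i α x) e₁).trans
      (mul_le_mul_of_nonneg_right (hb x) (norm_nonneg e₁))
    have k3 := (real_inner_le_norm (P.bv i α y) e₂).trans
      (mul_le_mul_of_nonneg_right (hb y) (norm_nonneg e₂))
    rw [this]; linarith
  have e3 : P.cz i α x * (s i - t i) - C * r * b ≤ P.cz i α x * s i - P.cz i α y * t i := by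
    have k := (abs_mul (P.cz i α x - P.cz i α y) (t i)).le.trans
      (mul_le_mul (hcL x y) (ht i) (abs_nonneg _) (by positivity))
    have := neg_le_of_abs_le k
    linarith
  have e4 : P.runCost i α x - P.runCost i α y ≤ C * r := (le_abs_self _).trans (hℓL x y)
  have e5 : ∑ j ∈ Finset.univ.erase i, P.dcp i j α x * s j
      - ∑ j ∈ Finset.univ.erase i, P.dcp i j α y * t j
      ≤ (∑ j ∈ Finset.univ.erase i, P.dcp i j α x) * (s i - t i) + M * (C * r * b) := by
    have k : ∀ j ∈ Finset.univ.erase i, P.dcp i j α x * s j - P.dcp i j α y * t j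
        ≤ P.dcp i j α x * (s i - t i) + C * r * b := by
      intro j hj
      have k1 := mul_le_mul_of_nonneg_left (hst j) (hd0 j hj x)
      have k2 := (le_abs_self _).trans ((abs_mul (P.dcp i j α x - P.dcp i j α y) (t j)).le.trans
        (mul_le_mul ((hd j).2 x y) (ht j) (abs_nonneg _) (by positivity)))
      linarith
    rw [← Finset.sum_sub_distrib]
    refine (Finset.sum_le_sum k).trans ?_
    rw [Finset.sum_add_distrib, ← Finset.sum_mul, Finset.sum_const, nsmul_eq_mul]
    have hcard : ((Finset.univ.erase i).card : ℝ) ≤ M := by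
      have := Finset.card_le_univ (Finset.univ.erase i)
      rw [Fintype.card_fin] at this
      exact_mod_cast this
    gcongr
  have e6 := mul_le_mul_of_nonneg_right (hlam x) hm
  have e7 : ∀ (B : E d →L[ℝ] E d) (c : ℝ) (V : Fin d' → E d),
      ∑ l, ⟪(B + c • ContinuousLinearMap.id ℝ (E d)) (V l), V l⟫
        = ∑ l, ⟪B (V l), V l⟫ + c * ∑ l, ‖V l‖ ^ 2 := by
    intro B c V
    rw [Finset.mul_sum, ← Finset.sum_add_distrib]
    refine Finset.sum_congr rfl fun l _ => ?_
    simp only [_root_.add_apply, _root_.smul_apply, ContinuousLinearMap.id_apply, inner_add_left,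
      real_inner_smul_left, real_inner_self_eq_norm_sq]
  rw [HJBData.L_formMatrix, HJBData.L_formMatrix, e7, e7]
  have e8 := mul_le_mul_of_nonneg_left hV2 hε
  have e9 := mul_le_mul_of_nonneg_left hW2 hε
  linarith

lemma H1.mul_sub_le {P : HJBData d d' M 𝒜} {C lam0 : ℝ} (h1 : H1 P C lam0) {i : Fin M}
    {x y : E d} {s t : Fin M → ℝ} {b : ℝ} (hm : 0 ≤ s i - t i)
    (hst : ∀ j, s j - t j ≤ s i - t i) (ht : ∀ j, |t j| ≤ b) {g e₁ e₂ : E d}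
    {B T : E d →L[ℝ] E d} {θ δ : ℝ} (hθ : 0 ≤ θ) (hδ : 0 ≤ δ)
    (hBT : ∀ v w, ⟪B v, v⟫ - ⟪T w, w⟫ ≤ θ * ‖v - w‖ ^ 2 + 2 * δ * ‖v‖ ^ 2) {R S : ℝ}
    (hx : ∀ ε > (0 : ℝ), P.Ham i x s (g + e₁)
      (formMatrix (B + (2 * ε) • ContinuousLinearMap.id ℝ (E d))) + R ≤ 0)
    (hy : ∀ ε > (0 : ℝ), 0 ≤ P.Ham i y t (g - e₂)
      (formMatrix (T + (2 * (-ε)) • ContinuousLinearMap.id ℝ (E d))) + S) :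
    lam0 * (s i - t i) ≤ S - R + (1 / 2 * θ * C ^ 2 * ‖x - y‖ ^ 2 + δ * C ^ 2
      + C * ‖x - y‖ * ‖g‖ + C * (‖e₁‖ + ‖e₂‖) + C * ‖x - y‖ * (b + 1 + M * b)) := by
  refine le_of_forall_pos_le_add fun η hη => ?_
  obtain ⟨ε, hε, hεη⟩ : ∃ ε > 0, 2 * ε * C ^ 2 ≤ η := by
    refine ⟨η / (2 * C ^ 2 + 1), by positivity, ?_⟩
    rw [mul_div_assoc', div_mul_eq_mul_div, div_le_iff₀ (by positivity)]
    nlinarith [sq_nonneg C]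
  have h2 := hx ε hε
  have h3 := hy ε hε
  have h4 : P.Ham i y t (g - e₂) (formMatrix (T + (2 * (-ε)) • ContinuousLinearMap.id ℝ (E d)))
      ≤ P.Ham i x s (g + e₁) (formMatrix (B + (2 * ε) • ContinuousLinearMap.id ℝ (E d)))
        + (1 / 2 * θ * C ^ 2 * ‖x - y‖ ^ 2 + δ * C ^ 2 + C * ‖x - y‖ * ‖g‖
          + C * (‖e₁‖ + ‖e₂‖) + C * ‖x - y‖ * (b + 1 + M * b) + 2 * ε * C ^ 2)
        - lam0 * (s i - t i) := by
    refine csSup_le ((h1.2.1 i).1.image _) ?_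
    rintro _ ⟨α, hα, rfl⟩
    have k1 := h1.L_le hα hm hst ht hθ hδ hε.le hBT (g := g) (e₁ := e₁) (e₂ := e₂) (x := x) (y := y)
    have k2 := le_csSup (h1.bddAbove_L i x s (g + e₁)
      (B + (2 * ε) • ContinuousLinearMap.id ℝ (E d))) ⟨α, hα, rfl⟩
    simp only [HJBData.Ham]
    linarith
  linarith

section Doubling

variable {F : Type*} [NormedAddCommGroup F] [InnerProductSpace ℝ F]

/-- Doubling of variables with quadratic penalties, a linear perturbation, and auxiliary points
`ξ`, `η` that realize the Lasry–Lions regularization. -/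
def doubling (μ θ δ : ℝ) (p₁ p₂ : F) (u v : F → ℝ) (x y ξ η : F) : ℝ :=
  u x - v y - μ / 2 * ‖x - ξ‖ ^ 2 - μ / 2 * ‖y - η‖ ^ 2 - θ / 2 * ‖ξ - η‖ ^ 2 - δ * ‖ξ‖ ^ 2
    - ⟪p₁, ξ⟫ - ⟪p₂, η⟫

variable {μ θ δ b : ℝ} {u v : F → ℝ}

lemma sum_le_of_sum_sq_le {a₁ a₂ a₃ a₄ m b c : ℝ} (hm : 0 < m) (hb : 0 ≤ b) (hc : 0 ≤ c)
    (h : m * (a₁ ^ 2 + a₂ ^ 2 + a₃ ^ 2 + a₄ ^ 2) ≤ b + c * (a₁ + a₂ + a₃ + a₄)) :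
    a₁ + a₂ + a₃ + a₄ ≤ 4 / m * (b + c) + 1 := by
  have hsq : (a₁ + a₂ + a₃ + a₄) ^ 2 ≤ 4 * (a₁ ^ 2 + a₂ ^ 2 + a₃ ^ 2 + a₄ ^ 2) := by
    linarith [sq_nonneg (a₁ - a₂), sq_nonneg (a₁ - a₃), sq_nonneg (a₁ - a₄), sq_nonneg (a₂ - a₃),
      sq_nonneg (a₂ - a₄), sq_nonneg (a₃ - a₄)]
  set N := a₁ + a₂ + a₃ + a₄
  have h5 : 0 ≤ 4 / m * (b + c) := by positivity
  by_contra! hlt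
  have hN : 1 ≤ N := by linarith
  have h6 := mul_le_mul_of_nonneg_left hsq hm.le
  have h7 := mul_le_mul_of_nonneg_left hN hb
  have h8 : m * N ≤ 4 * (b + c) := le_of_mul_le_mul_right (by linarith) (by linarith : 0 < N)
  have h9 : N ≤ 4 / m * (b + c) := by
    rw [div_mul_eq_mul_div, le_div_iff₀ hm]; linarith
  linarith

lemma exists_max_doubling [FiniteDimensional ℝ F] (hμ : 0 < μ) (hθ : 0 < θ) (hδ : 0 < δ)
    (hu : Continuous u) (hv : Continuous v) (hub : ∀ x, |u x| ≤ b) (hvb : ∀ x, |v x| ≤ b)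
    (p₁ p₂ : F) :
    ∃ x y ξ η, ∀ x' y' ξ' η',
      doubling μ θ δ p₁ p₂ u v x' y' ξ' η' ≤ doubling μ θ δ p₁ p₂ u v x y ξ η := by
  let f : F × F × F × F → ℝ := fun z => doubling μ θ δ p₁ p₂ u v z.1 z.2.1 z.2.2.1 z.2.2.2
  have hf : Continuous f := by unfold f doubling; fun_prop
  have hproper : ProperSpace F := FiniteDimensional.proper_real F
  obtain ⟨m, hm, hm1, hm2, hm3⟩ : ∃ m > 0, m ≤ μ / 2 ∧ m ≤ θ / 2 ∧ m ≤ δ :=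
    ⟨min (μ / 2) (min (θ / 2) δ), by positivity, min_le_left _ _,
      (min_le_right _ _).trans (min_le_left _ _), (min_le_right _ _).trans (min_le_right _ _)⟩
  have hb : 0 ≤ b := (abs_nonneg _).trans (hub 0)
  set c := ‖p₁‖ + ‖p₂‖ with hc
  set R := 4 / m * (4 * b + c) + 1 with hR
  obtain ⟨z, hz⟩ := hf.exists_forall_ge' (0, 0, 0, 0) (by
    filter_upwards [(isCompact_closedBall (0 : F × F × F × F) R).compl_mem_cocompact]
    rintro ⟨x, y, ξ, η⟩ hz
    by_contra! hlt
    refine hz (mem_closedBall_zero_iff.2 ?_)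
    simp only [f, doubling, sub_zero, norm_zero, inner_zero_right] at hlt
    have k1 := abs_le.1 (hub 0)
    have k2 := abs_le.1 (hvb 0)
    have k3 := abs_le.1 (hub x)
    have k4 := abs_le.1 (hvb y)
    have k5 := neg_le_of_abs_le (abs_real_inner_le_norm p₁ ξ)
    have k6 := neg_le_of_abs_le (abs_real_inner_le_norm p₂ η)
    have t1 : ‖x‖ ≤ ‖x - ξ‖ + ‖ξ‖ := norm_le_norm_sub_add x ξ
    have t2 : ‖η‖ ≤ ‖ξ - η‖ + ‖ξ‖ := norm_sub_rev ξ η ▸ norm_le_norm_sub_add η ξ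
    have t3 : ‖y‖ ≤ ‖y - η‖ + ‖η‖ := norm_le_norm_sub_add y η
    set N := ‖x - ξ‖ + ‖y - η‖ + ‖ξ - η‖ + ‖ξ‖ with hN
    have n1 := norm_nonneg (x - ξ)
    have n2 := norm_nonneg (y - η)
    have n3 := norm_nonneg (ξ - η)
    have n4 := norm_nonneg ξ
    have hNR : N ≤ R := by
      refine sum_le_of_sum_sq_le hm (by positivity) (by positivity) ?_
      have j1 := mul_le_mul_of_nonneg_right hm1 (sq_nonneg ‖x - ξ‖)
      have j2 := mul_le_mul_of_nonneg_right hm1 (sq_nonneg ‖y - η‖)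
      have j3 := mul_le_mul_of_nonneg_right hm2 (sq_nonneg ‖ξ - η‖)
      have j4 := mul_le_mul_of_nonneg_right hm3 (sq_nonneg ‖ξ‖)
      have j5 : ‖p₁‖ * ‖ξ‖ ≤ ‖p₁‖ * N := by gcongr; linarith
      have j6 : ‖p₂‖ * ‖η‖ ≤ ‖p₂‖ * N := by gcongr; linarith
      rw [← hN, hc, add_mul]
      linarith
    simp only [Prod.norm_def, sup_le_iff]
    refine ⟨?_, ?_, ?_, ?_⟩ <;> linarith)
  exact ⟨z.1, z.2.1, z.2.2.1, z.2.2.2, fun x' y' ξ' η' => hz (x', y', ξ', η')⟩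

lemma lasryLions_le_of_max_doubling (hμ : 0 < μ) (hδ : 0 < δ) (hδμ : θ + 2 * δ ≤ μ)
    (hub : ∀ x, |u x| ≤ b) (hvb : ∀ x, |v x| ≤ b) {p₁ p₂ : F} {J : ℝ}
    (hJ : ∀ x y ξ η, doubling μ θ δ p₁ p₂ u v x y ξ η ≤ J) (ξ η : F) :
    lasryLions μ u ξ + lasryLions μ (fun y => -v y) η - θ / 2 * ‖ξ - η‖ ^ 2 - δ * ‖ξ‖ ^ 2
      - ⟪p₁, ξ⟫ - ⟪p₂, η⟫ ≤ J := by
  have hvb' : ∀ x, |-v x| ≤ b := fun x => (abs_neg _).le.trans (hvb x)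
  have key : ∀ y η, lasryLions μ u ξ ≤ J + v y + μ / 2 * ‖y - η‖ ^ 2 + θ / 2 * ‖ξ - η‖ ^ 2
      + δ * ‖ξ‖ ^ 2 + ⟪p₁, ξ⟫ + ⟪p₂, η⟫ := by
    intro y η
    refine lasryLions_le_of_paraboloid hμ hub hδμ
      (a := θ • (ξ - η) + (2 * δ) • ξ + p₁) fun x ξ' => ?_
    obtain ⟨k, rfl⟩ : ∃ k, ξ' = ξ + k := ⟨ξ' - ξ, by abel⟩
    have := hJ x y (ξ + k) η
    have e1 : ‖ξ + k - η‖ ^ 2 = ‖ξ - η‖ ^ 2 + 2 * ⟪ξ - η, k⟫ + ‖k‖ ^ 2 := by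
      rw [show ξ + k - η = (ξ - η) + k by abel, norm_add_sq_real]
    rw [doubling, e1, norm_add_sq_real ξ k, inner_add_right] at this
    simp only [add_sub_cancel_left, inner_add_left, real_inner_smul_left]
    linarith
  have hLL := lasryLions_le_of_paraboloid hμ hvb' (β := θ) (by linarith) (q := η)
    (a := θ • (η - ξ) + p₂) (c := J - lasryLions μ u ξ + θ / 2 * ‖ξ - η‖ ^ 2
      + δ * ‖ξ‖ ^ 2 + ⟪p₁, ξ⟫ + ⟪p₂, η⟫) fun y η' => by
    obtain ⟨k, rfl⟩ : ∃ k, η' = η + k := ⟨η' - η, by abel⟩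
    have := key y (η + k)
    have e1 : ‖ξ - (η + k)‖ ^ 2 = ‖ξ - η‖ ^ 2 + 2 * ⟪η - ξ, k⟫ + ‖k‖ ^ 2 := by
      rw [norm_sub_rev, show η + k - ξ = (η - ξ) + k by abel, norm_add_sq_real, norm_sub_rev]
    rw [e1, inner_add_right] at this
    simp only [add_sub_cancel_left, inner_add_left, real_inner_smul_left]
    linarith
  linarith

/-- Maximum principle for semicontinuous functions, in the form needed for weakly coupled systems:
after a small linear perturbation, the doubled functional has a maximum point at which second-order
jets with ordered Hessian forms exist. -/
theorem exists_doubling_jets [FiniteDimensional ℝ F] {ι : Type*} [Finite ι] [Nonempty ι]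
    {u v : ι → F → ℝ} (hμ : 0 < μ) (hθ : 0 < θ) (hδ : 0 < δ) (hδμ : θ + 2 * δ ≤ μ)
    (hu : ∀ i, Continuous (u i)) (hv : ∀ i, Continuous (v i)) (hub : ∀ i x, |u i x| ≤ b)
    (hvb : ∀ i x, |v i x| ≤ b) {r : ℝ} (hr : 0 < r) :
    ∃ p₁ p₂ : F, ‖p₁‖ < r ∧ ‖p₂‖ < r ∧ ∃ i x y ξ η, ∃ B T : F →L[ℝ] F,
      (∀ j x' y' ξ' η', doubling μ θ δ p₁ p₂ (u j) (v j) x' y' ξ' η'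
        ≤ doubling μ θ δ p₁ p₂ (u i) (v i) x y ξ η) ∧
      (∀ ε > (0 : ℝ), ∀ᶠ k in 𝓝 (0 : F), u i (x + k) ≤ u i x
        + ⟪θ • (ξ - η) + ((2 * δ) • ξ + p₁), k⟫ + 1 / 2 * ⟪B k, k⟫ + ε * ‖k‖ ^ 2) ∧
      (∀ ε > (0 : ℝ), ∀ᶠ k in 𝓝 (0 : F), v i y + ⟪θ • (ξ - η) - p₂, k⟫ + 1 / 2 * ⟪T k, k⟫
        + (-ε) * ‖k‖ ^ 2 ≤ v i (y + k)) ∧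
      ∀ z w, ⟪B z, z⟫ - ⟪T w, w⟫ ≤ θ * ‖z - w‖ ^ 2 + 2 * δ * ‖z‖ ^ 2 := by
  have hvb' : ∀ i x, |-v i x| ≤ b := fun i x => (abs_neg _).le.trans (hvb i x)
  choose P hP using fun i => exists_paraboloids_lasryLions hμ (hub i)
  choose S' hS' using fun i => exists_paraboloids_lasryLions hμ (hvb' i)
  set k : ι → F → ℝ := fun i η => -lasryLions μ (fun y => -v i y) η with hk
  have hS : ∀ i q w, |k i w - k i q - ⟪-S' i q, w - q⟫| ≤ μ / 2 * ‖w - q‖ ^ 2 := by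
    intro i q w
    rw [inner_neg_left, ← abs_neg]
    convert hS' i q w using 2
    simp only [hk]
    ring
  obtain ⟨p₁, p₂, h₁, h₂, hgen⟩ := exists_generic_perturbation
    (fun i => norm_sub_le_of_paraboloids (hP i)) (fun i => norm_sub_le_of_paraboloids (hS i))
    θ (2 * δ) hr
  choose X Y Ξ H hmax using fun i =>
    exists_max_doubling hμ hθ hδ (hu i) (hv i) (hub i) (hvb i) p₁ p₂
  obtain ⟨i, hi⟩ := Finite.exists_max fun i =>
    doubling μ θ δ p₁ p₂ (u i) (v i) (X i) (Y i) (Ξ i) (H i)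
  have hJ : ∀ j x' y' ξ' η', doubling μ θ δ p₁ p₂ (u j) (v j) x' y' ξ' η'
      ≤ doubling μ θ δ p₁ p₂ (u i) (v i) (X i) (Y i) (Ξ i) (H i) :=
    fun j x' y' ξ' η' => (hmax j x' y' ξ' η').trans (hi j)
  clear hi hmax
  generalize X i = x, Y i = y, Ξ i = ξ, H i = η at hJ
  have hle := lasryLions_le_of_max_doubling hμ hδ hδμ (hub i) (hvb i) (hJ i)
  have e₁ := le_lasryLions hμ (hub i) x ξ
  have e₂ := le_lasryLions hμ (hvb' i) y η
  have e₃ := hle ξ η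
  rw [doubling] at e₃
  have hcrit : ∀ ξ' η', lasryLions μ (u i) ξ' - k i η' - θ / 2 * ‖ξ' - η'‖ ^ 2 - δ * ‖ξ'‖ ^ 2
      - ⟪p₁, ξ'⟫ - ⟪p₂, η'⟫ ≤ lasryLions μ (u i) ξ - k i η - θ / 2 * ‖ξ - η‖ ^ 2 - δ * ‖ξ‖ ^ 2
      - ⟪p₁, ξ⟫ - ⟪p₂, η⟫ := by
    intro ξ' η'
    have := hle ξ' η'
    rw [doubling] at this
    simp only [hk]
    linarith
  obtain ⟨f₁, f₂⟩ := first_order_condition (hP i) (hS i) hcrit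
  obtain ⟨hB, hT⟩ := hgen i ξ η f₁ f₂
  refine ⟨p₁, p₂, h₁, h₂, i, x, y, ξ, η, fderiv ℝ (P i) ξ, fderiv ℝ (fun q => -S' i q) η, hJ,
    fun ε hε => ?_, fun ε hε => ?_,
    second_order_condition (hP i) (hS i) hcrit hB.hasFDerivAt hT.hasFDerivAt⟩
  · filter_upwards [second_order_expansion (hP i) hB.hasFDerivAt hε] with z hz
    have h3 := le_lasryLions hμ (hub i) (x + z) (ξ + z)
    have h4 := (abs_le.1 hz).2
    rw [add_sub_add_right_eq_sub] at h3
    rw [f₁, add_assoc] at h4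
    linarith
  · filter_upwards [second_order_expansion (hS i) hT.hasFDerivAt hε] with z hz
    have h3 := le_lasryLions hμ (hvb' i) (y + z) (η + z)
    have h4 := (abs_le.1 hz).1
    rw [add_sub_add_right_eq_sub] at h3
    rw [f₂] at h4
    simp only [hk] at h4
    linarith

end Doubling

lemma exists_modulus_on_ball {F : Type*} [NormedAddCommGroup F] [ProperSpace F] {ι : Type*}
    [Finite ι] {f : ι → F → ℝ} (hf : ∀ i, Continuous (f i)) (R : ℝ) {τ : ℝ} (hτ : 0 < τ) :
    ∃ s > 0, ∀ i x y, ‖x‖ ≤ R → ‖y‖ ≤ R → ‖x - y‖ < s → |f i x - f i y| ≤ τ := by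
  have := Fintype.ofFinite ι
  have hc : Continuous fun x i => f i x := continuous_pi hf
  have huc := (isCompact_closedBall (0 : F) R).uniformContinuousOn_of_continuous hc.continuousOn
  obtain ⟨s, hs, h⟩ := Metric.uniformContinuousOn_iff.1 huc τ hτ
  refine ⟨s, hs, fun i x y hx hy hxy => ?_⟩
  have := h x (by simpa using hx) y (by simpa using hy) (by rwa [dist_eq_norm])
  exact ((dist_le_pi_dist _ _ i).trans_lt this).le

/-- Doubling of variables with all penalization errors controlled by a single parameter `τ`. -/
theorem exists_doubling_jets_small {F : Type*} [NormedAddCommGroup F] [InnerProductSpace ℝ F]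
    [FiniteDimensional ℝ F] {ι : Type*} [Finite ι] {u v Ψ : ι → F → ℝ} {b : ℝ}
    (hu : ∀ i, Continuous (u i)) (hv : ∀ i, Continuous (v i)) (hΨ : ∀ i, Continuous (Ψ i))
    (hub : ∀ i x, |u i x| ≤ b) (hvb : ∀ i x, |v i x| ≤ b) (i₀ : ι) (x₀ : F) {τ : ℝ} (hτ : 0 < τ)
    (hτ1 : τ ≤ 1) :
    ∃ θ ≥ (0 : ℝ), ∃ i x y g e₁ e₂, ∃ B T : F →L[ℝ] F,
      (∀ j, u j x - v j y ≤ u i x - v i y) ∧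
      (∀ ε > (0 : ℝ), ∀ᶠ k in 𝓝 (0 : F), u i (x + k) ≤ u i x
        + ⟪g + e₁, k⟫ + 1 / 2 * ⟪B k, k⟫ + ε * ‖k‖ ^ 2) ∧
      (∀ ε > (0 : ℝ), ∀ᶠ k in 𝓝 (0 : F), v i y + ⟪g - e₂, k⟫ + 1 / 2 * ⟪T k, k⟫
        + (-ε) * ‖k‖ ^ 2 ≤ v i (y + k)) ∧
      (∀ z w, ⟪B z, z⟫ - ⟪T w, w⟫ ≤ θ * ‖z - w‖ ^ 2 + 2 * τ ^ 2 * ‖z‖ ^ 2) ∧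
      θ * ‖x - y‖ ^ 2 ≤ 18 * τ ∧ ‖x - y‖ * ‖g‖ ≤ 12 * τ ∧ ‖e₁‖ + ‖e₂‖ ≤ (8 * b + 5) * τ ∧
      ‖x - y‖ ≤ τ ∧ |Ψ i x - Ψ i y| ≤ τ ∧
      u i₀ x₀ - v i₀ x₀ ≤ u i x - v i y + (2 + ‖x₀‖ ^ 2 + 2 * ‖x₀‖) * τ := by
  have : Nonempty ι := ⟨i₀⟩
  have hproper : ProperSpace F := FiniteDimensional.proper_real F
  have hb : 0 ≤ b := (abs_nonneg _).trans (hub i₀ x₀)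
  set D := 8 * b + 2 with hD
  set R := D / τ ^ 2 + 4 with hR
  obtain ⟨s₁, hs₁, hmu⟩ := exists_modulus_on_ball hu R hτ
  obtain ⟨s₂, hs₂, hmv⟩ := exists_modulus_on_ball hv R hτ
  obtain ⟨s₃, hs₃, hmΨ⟩ := exists_modulus_on_ball hΨ R hτ
  obtain ⟨s, hs, hsτ, hss₁, hss₂, hss₃⟩ : ∃ s > 0, s ≤ τ ∧ s ≤ s₁ ∧ s ≤ s₂ ∧ s ≤ s₃ :=
    ⟨min τ (min s₁ (min s₂ s₃)), by positivity, by simp, by simp, by simp, by simp⟩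
  obtain ⟨μ, hμ4, hμs⟩ : ∃ μ : ℝ, 4 ≤ μ ∧ 4 * D < μ * (s / 4) ^ 2 := by
    refine ⟨max 4 (4 * D / (s / 4) ^ 2 + 1), le_max_left _ _, ?_⟩
    refine lt_of_lt_of_le ?_ (mul_le_mul_of_nonneg_right (le_max_right _ _) (by positivity))
    rw [add_mul, div_mul_cancel₀ _ (by positivity)]
    have : 0 < (s / 4) ^ 2 := by positivity
    linarith
  have hμ : 0 < μ := by linarith
  have hτ2 : τ ^ 2 ≤ τ := by nlinarith
  have hδ : 0 < τ ^ 2 := by positivity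
  set r := τ ^ 2 / 4 with hr
  obtain ⟨p₁, p₂, hp₁, hp₂, i, x, y, ξ, η, B, T, hJ, hjet₁, hjet₂, hBT⟩ :=
    exists_doubling_jets (θ := μ / 2) hμ (by positivity) hδ (by linarith) hu hv hub hvb
      (r := r) (by positivity)
  have hn := norm_nonneg ξ
  set a₁ := ‖x - ξ‖ with ha₁
  set a₂ := ‖y - η‖ with ha₂
  set c := ‖ξ - η‖ with hc
  have ha₁0 : 0 ≤ a₁ := norm_nonneg _
  have ha₂0 : 0 ≤ a₂ := norm_nonneg _
  have hc0 : 0 ≤ c := norm_nonneg _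
  set n := ‖ξ‖ with hnd
  have hr0 : 0 < r := by positivity
  have hηn : ‖η‖ ≤ n + c := by
    have := norm_le_norm_sub_add η ξ
    rw [norm_sub_rev] at this
    linarith
  -- linear perturbations are absorbed by the quadratic penalties
  have q₁ : |⟪p₁, ξ⟫| ≤ r * n :=
    (abs_real_inner_le_norm _ _).trans (by gcongr)
  have q₂ : |⟪p₂, η⟫| ≤ r * (n + c) :=
    (abs_real_inner_le_norm _ _).trans (by gcongr)
  have q₃ : r * n + r * (n + c) ≤ 3 / 2 * r + (τ ^ 2 * n ^ 2 + μ / 4 * c ^ 2) / 4 := by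
    have m₁ := mul_nonneg hr0.le (sq_nonneg (n - 1))
    have m₂ := mul_nonneg hr0.le (sq_nonneg (c - 1))
    have m₃ : r * c ^ 2 ≤ μ / 8 * c ^ 2 := by gcongr; linarith
    have m₄ : r * n ^ 2 = τ ^ 2 * n ^ 2 / 4 := by rw [hr]; ring
    linarith
  have k₁ : 0 ≤ μ * a₁ ^ 2 := by positivity
  have k₂ : 0 ≤ μ * a₂ ^ 2 := by positivity
  have k₃ : 0 ≤ μ * c ^ 2 := by positivity
  have k₄ : 0 ≤ τ ^ 2 * n ^ 2 := by positivity
  have hquad : μ / 2 * a₁ ^ 2 + μ / 2 * a₂ ^ 2 + μ / 4 * c ^ 2 + τ ^ 2 * n ^ 2 ≤ D := by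
    have h := hJ i 0 0 0 0
    simp only [doubling, sub_zero, norm_zero, inner_zero_right] at h
    have k1 := abs_le.1 (hub i 0)
    have k2 := abs_le.1 (hvb i 0)
    have k3 := abs_le.1 (hub i x)
    have k4 := abs_le.1 (hvb i y)
    have k5 := abs_le.1 q₁
    have k6 := abs_le.1 q₂
    linarith
  have hsmall : ∀ t, 0 ≤ t → μ / 4 * t ^ 2 ≤ D → t < s / 4 := by
    intro t ht h
    refine lt_of_pow_lt_pow_left₀ 2 (by positivity) ?_
    refine lt_of_mul_lt_mul_left (a := μ) ?_ hμ.le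
    linarith
  have s1 : a₁ < s / 4 := hsmall _ ha₁0 (by linarith)
  have s2 : a₂ < s / 4 := hsmall _ ha₂0 (by linarith)
  have s3 : c < s / 4 := hsmall _ hc0 (by linarith)
  have hτn : τ ^ 2 * n ^ 2 ≤ D := by linarith
  have hnR : n + 3 ≤ R := by
    have : n ^ 2 ≤ D / τ ^ 2 := by rw [le_div_iff₀ hδ]; linarith
    linarith [sq_nonneg (n - 1), sq_nonneg n]
  have hx : ‖x‖ ≤ R := by
    have := norm_le_norm_sub_add x ξ
    linarith
  have hy : ‖y‖ ≤ R := by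
    have := norm_le_norm_sub_add y η
    linarith
  have hyξ : ‖y - ξ‖ ≤ a₂ + c := by
    have := norm_sub_le_norm_sub_add_norm_sub y η ξ
    rwa [norm_sub_rev η ξ] at this
  have hxy : ‖x - y‖ ≤ a₁ + (a₂ + c) := by
    have := norm_sub_le_norm_sub_add_norm_sub x ξ y
    rw [norm_sub_rev ξ y] at this
    linarith
  have hpen : μ / 2 * a₁ ^ 2 + μ / 2 * a₂ ^ 2 + μ / 4 * c ^ 2 ≤ 3 * τ := by
    have h := hJ i ξ ξ ξ ξ
    have k1 := (abs_le.1 (hmu i x ξ hx (by linarith) (by linarith))).2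
    have k2 := (abs_le.1 (hmv i y ξ hy (by linarith) (by linarith))).1
    have k3 : ⟪p₂, ξ⟫ - ⟪p₂, η⟫ ≤ r * c := by
      rw [← inner_sub_right]
      exact (real_inner_le_norm _ _).trans (by gcongr)
    have k4 : r * c ≤ τ := by
      refine (mul_le_mul (by linarith : r ≤ 1) (by linarith : c ≤ τ) hc0 zero_le_one).trans ?_
      rw [one_mul]
    simp only [doubling, sub_self, norm_zero] at h
    linarith
  have hxy2 : μ / 2 * ‖x - y‖ ^ 2 ≤ 18 * τ := by
    have : ‖x - y‖ ^ 2 ≤ 3 * (a₁ ^ 2 + a₂ ^ 2 + c ^ 2) := by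
      have := pow_le_pow_left₀ (norm_nonneg _) hxy 2
      linarith [sq_nonneg (a₁ - a₂), sq_nonneg (a₁ - c), sq_nonneg (a₂ - c)]
    have := mul_le_mul_of_nonneg_left this (by positivity : 0 ≤ μ / 2)
    linarith
  refine ⟨μ / 2, by positivity, i, x, y, (μ / 2) • (ξ - η), (2 * τ ^ 2) • ξ + p₁, p₂, B, T,
    fun j => ?_, hjet₁, hjet₂, hBT, hxy2, ?_, ?_, by linarith,
    hmΨ i x y hx hy (by linarith), ?_⟩
  · have := hJ j x y ξ η
    simp only [doubling] at this
    linarith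
  · rw [norm_smul, Real.norm_of_nonneg (by positivity)]
    have := mul_nonneg (by positivity : 0 ≤ μ / 4) (sq_nonneg (‖x - y‖ - c))
    linarith
  · have h := norm_add_le ((2 * τ ^ 2) • ξ) p₁
    rw [norm_smul, Real.norm_of_nonneg (by positivity), ← hnd] at h
    have h2 : 2 * τ ^ 2 * n ≤ τ * (τ ^ 2 * n ^ 2 + 1) := by
      linarith [mul_nonneg hτ.le (sq_nonneg (τ * n - 1))]
    have h3 := mul_le_mul_of_nonneg_left hτn hτ.le
    linarith
  · have h := hJ i₀ x₀ x₀ x₀ x₀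
    simp only [doubling, sub_self, norm_zero] at h
    have k1 : ⟪p₁, x₀⟫ ≤ r * ‖x₀‖ := (real_inner_le_norm _ _).trans (by gcongr)
    have k2 : ⟪p₂, x₀⟫ ≤ r * ‖x₀‖ := (real_inner_le_norm _ _).trans (by gcongr)
    have k3 := (abs_le.1 q₁).1
    have k4 := (abs_le.1 q₂).1
    have k5 : r * ‖x₀‖ ≤ τ * ‖x₀‖ := by gcongr; linarith
    have k6 : τ ^ 2 * ‖x₀‖ ^ 2 ≤ τ * ‖x₀‖ ^ 2 := by gcongr
    linarith

/-- Stable comparison principle for the penalized obstacle problem. -/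
theorem H1.comparison {P : HJBData d d' M 𝒜} {C lam0 : ℝ} (h1 : H1 P C lam0) {ρ : ℝ} (hρ : 0 ≤ ρ)
    {u v Ψ₁ Ψ₂ : Fin M → E d → ℝ} (hub : Bdd u) (hvb : Bdd v) (hu : ∀ i, Continuous (u i))
    (hv : ∀ i, Continuous (v i)) (hΨ : ∀ i, Continuous (Ψ₁ i)) {ε : ℝ} (hε : 0 ≤ ε)
    (hΨε : ∀ i x, Ψ₁ i x ≤ Ψ₂ i x + ε) (hsub : IsSubsolution (FobPen P Ψ₁ ρ) u)
    (hsup : IsSupersolution (FobPen P Ψ₂ ρ) v) (i₀ : Fin M) (x₀ : E d) :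
    u i₀ x₀ ≤ v i₀ x₀ + ρ / (lam0 + ρ) * ε := by
  have hlam := h1.1
  have hC := h1.nonneg i₀
  obtain ⟨b, hub, hvb⟩ : ∃ b, (∀ i x, |u i x| ≤ b) ∧ ∀ i x, |v i x| ≤ b := by
    obtain ⟨b₁, hb₁⟩ := hub
    obtain ⟨b₂, hb₂⟩ := hvb
    exact ⟨max b₁ b₂, fun i x => (hb₁ i x).trans (le_max_left _ _),
      fun i x => (hb₂ i x).trans (le_max_right _ _)⟩
  have hb : 0 ≤ b := (abs_nonneg _).trans (hub i₀ x₀)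
  set K₁ := 10 * C ^ 2 + 12 * C + C * (8 * b + 5) + C * (b + 1 + M * b) with hK₁
  set K₂ := 2 + ‖x₀‖ ^ 2 + 2 * ‖x₀‖ with hK₂
  have hK₁0 : 0 ≤ K₁ := by positivity
  have key : ∀ τ ∈ Set.Ioc (0 : ℝ) 1,
      u i₀ x₀ ≤ v i₀ x₀ + ρ / (lam0 + ρ) * ε + (1 + K₁ / lam0 + K₂) * τ := by
    rintro τ ⟨hτ, hτ1⟩
    obtain ⟨θ, hθ, i, x, y, g, e₁, e₂, B, T, hcoup, hjet₁, hjet₂, hBT, t₁, t₂, t₃, t₄, t₅, t₆⟩ :=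
      exists_doubling_jets_small hu hv hΨ hub hvb i₀ x₀ hτ hτ1
    have hfrac : 0 ≤ ρ / (lam0 + ρ) * ε := by positivity
    have hfrac1 : ρ / (lam0 + ρ) ≤ 1 := div_le_one_of_le₀ (by linarith) (by positivity)
    suffices u i x - v i y ≤ ρ / (lam0 + ρ) * ε + (1 + K₁ / lam0) * τ by linarith
    rcases le_total (u i x - v i y) 0 with hneg | hm
    · have : 0 ≤ (1 + K₁ / lam0) * τ := by positivity
      linarith
    have hmain := h1.mul_sub_le (s := fun j => u j x) (t := fun j => v j y) hm
      (fun j => hcoup j) (fun j => hvb j y) hθ (sq_nonneg τ) hBT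
      (fun ε hε => hsub.le_of_superjet (hjet₁ ε hε)) (fun ε hε => hsup.le_of_subjet (hjet₂ ε hε))
    have herr : 1 / 2 * θ * C ^ 2 * ‖x - y‖ ^ 2 + τ ^ 2 * C ^ 2 + C * ‖x - y‖ * ‖g‖
        + C * (‖e₁‖ + ‖e₂‖) + C * ‖x - y‖ * (b + 1 + M * b) ≤ K₁ * τ := by
      have k₁ := mul_le_mul_of_nonneg_left t₁ (sq_nonneg C)
      have k₂ := mul_le_mul_of_nonneg_left t₂ hC
      have k₃ := mul_le_mul_of_nonneg_left t₃ hC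
      have k₄ := mul_le_mul_of_nonneg_left t₄ (by positivity : 0 ≤ C * (b + 1 + M * b))
      have k₅ : τ ^ 2 * C ^ 2 ≤ τ * C ^ 2 := by gcongr; nlinarith
      rw [hK₁]
      linarith
    have hobs : max (v i y - Ψ₂ i y) 0 ≤ max (u i x - Ψ₁ i x) 0
        + max (ε + τ - (u i x - v i y)) 0 := by
      have l₁ := le_max_left (u i x - Ψ₁ i x) 0
      have l₂ := le_max_right (u i x - Ψ₁ i x) 0
      have l₃ := le_max_left (ε + τ - (u i x - v i y)) 0
      have l₄ := le_max_right (ε + τ - (u i x - v i y)) 0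
      have l₅ := (abs_le.1 t₅).2
      have l₆ := hΨε i y
      exact max_le (by linarith) (by linarith)
    have hobs' := mul_le_mul_of_nonneg_left hobs hρ
    set m := u i x - v i y with hmdef
    have hineq : lam0 * m ≤ ρ * max (ε + τ - m) 0 + K₁ * τ := by linarith
    have hlr : 0 < lam0 + ρ := by positivity
    have hexp : ρ / (lam0 + ρ) * ε + (1 + K₁ / lam0) * τ
        = ρ / (lam0 + ρ) * ε + τ + K₁ * τ / lam0 := by ring
    rw [hexp]
    have hkτ : 0 ≤ K₁ * τ := by positivity
    rcases le_total (ε + τ - m) 0 with hcase | hcase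
    · rw [max_eq_right hcase, mul_zero, zero_add] at hineq
      have : m ≤ K₁ * τ / lam0 := by rw [le_div_iff₀ hlam]; linarith
      linarith
    · rw [max_eq_left hcase] at hineq
      have h₂ : m ≤ (ρ * (ε + τ) + K₁ * τ) / (lam0 + ρ) := by
        rw [le_div_iff₀ hlr]; linarith
      have h₃ : K₁ * τ / (lam0 + ρ) ≤ K₁ * τ / lam0 := by gcongr; linarith
      have h₄ : ρ / (lam0 + ρ) * τ ≤ 1 * τ := by gcongr
      have h₅ : (ρ * (ε + τ) + K₁ * τ) / (lam0 + ρ)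
          = ρ / (lam0 + ρ) * ε + ρ / (lam0 + ρ) * τ + K₁ * τ / (lam0 + ρ) := by ring
      linarith
  have hlim : Tendsto (fun τ : ℝ => v i₀ x₀ + ρ / (lam0 + ρ) * ε + (1 + K₁ / lam0 + K₂) * τ)
      (𝓝[>] 0) (𝓝 (v i₀ x₀ + ρ / (lam0 + ρ) * ε + (1 + K₁ / lam0 + K₂) * 0)) :=
    (Continuous.tendsto (by fun_prop) 0).mono_left nhdsWithin_le_nhds
  rw [mul_zero, add_zero] at hlim
  refine ge_of_tendsto hlim ?_
  filter_upwards [Ioc_mem_nhdsGT (zero_lt_one' ℝ)] with τ hτ using key τ hτ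

lemma H2.bddBelow {Q : ImpulseData d M 𝒵} {κ₀ : ℝ} (h2 : H2 Q κ₀) {u : Fin M → E d → ℝ}
    (hu : Bdd u) (i : Fin M) (x : E d) :
    BddBelow ((fun z => u i (Q.Γ i x z) + Q.K i x z) '' Q.Z i x) := by
  obtain ⟨b, hb⟩ := hu
  refine ⟨-b + κ₀, ?_⟩
  rintro _ ⟨z, hz, rfl⟩
  exact add_le_add (abs_le.1 (hb i _)).1 (h2.2.2.2.2.2 i x z hz)

lemma H2.Mop_le_add {Q : ImpulseData d M 𝒵} {κ₀ : ℝ} (h2 : H2 Q κ₀) {u w : Fin M → E d → ℝ}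
    (hu : Bdd u) {ε : ℝ} (huw : ∀ i x, u i x ≤ w i x + ε) (i : Fin M) (x : E d) :
    Q.Mop i u x ≤ Q.Mop i w x + ε := by
  rw [← sub_le_iff_le_add]
  refine le_csInf ((h2.2.1 i x).1.image _) ?_
  rintro _ ⟨z, hz, rfl⟩
  have h3 : Q.Mop i u x ≤ u i (Q.Γ i x z) + Q.K i x z :=
    csInf_le (h2.bddBelow hu i x) ⟨z, hz, rfl⟩
  have h4 := huw i (Q.Γ i x z)
  dsimp only
  linarith

/-- The minimum of a continuous function over a Hausdorff-continuous family of nonempty compact sets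
depends continuously on the parameter. -/
lemma H2.continuous_Mop {Q : ImpulseData d M 𝒵} {κ₀ : ℝ} (h2 : H2 Q κ₀) {u : Fin M → E d → ℝ}
    (hub : Bdd u) (hu : ∀ i, Continuous (u i)) (i : Fin M) :
    Continuous fun x => Q.Mop i u x := by
  obtain ⟨-, hZ, hΓ, hK, hH, -⟩ := id h2
  set f : E d → 𝒵 → ℝ := fun x z => u i (Q.Γ i x z) + Q.K i x z with hf
  have hfc : Continuous fun p : E d × 𝒵 => f p.1 p.2 := ((hu i).comp (hΓ i)).add (hK i)
  have hfin : ∀ x y, Metric.hausdorffEDist (Q.Z i x) (Q.Z i y) ≠ ⊤ := fun x y =>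
    Metric.hausdorffEDist_ne_top_of_nonempty_of_bounded (hZ i x).1 (hZ i y).1
      (hZ i x).2.isBounded (hZ i y).2.isBounded
  refine continuous_iff_continuousAt.2 fun x => ?_
  refine tendsto_order.2 ⟨fun a ha => ?_, fun a ha => ?_⟩
  · obtain ⟨a', haa', ha'⟩ := exists_between ha
    have hO : IsOpen {p : E d × 𝒵 | a' < f p.1 p.2} := isOpen_lt continuous_const hfc
    have hsub : {x} ×ˢ Q.Z i x ⊆ {p : E d × 𝒵 | a' < f p.1 p.2} := by
      rintro ⟨x', z⟩ ⟨hx', hz⟩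
      obtain rfl : x' = x := hx'
      exact ha'.trans_le (csInf_le (h2.bddBelow hub i x') ⟨z, hz, rfl⟩)
    obtain ⟨U, V, hU, hV, hxU, hZV, hUV⟩ :=
      generalized_tube_lemma isCompact_singleton (hZ i x).2 hO hsub
    obtain ⟨δ, hδ, hthick⟩ := (hZ i x).2.exists_thickening_subset_open hV hZV
    obtain ⟨δ', hδ', hdist⟩ := hH i x δ hδ
    filter_upwards [hU.mem_nhds (hxU rfl), Metric.ball_mem_nhds x hδ'] with y hyU hy
    refine haa'.trans_le (le_csInf ((hZ i y).1.image _) ?_)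
    rintro _ ⟨z, hz, rfl⟩
    obtain ⟨z', hz', hzz'⟩ := Metric.exists_dist_lt_of_hausdorffDist_lt' hz (hdist y hy) (hfin x y)
    have hzV : z ∈ V := hthick (Metric.mem_thickening_iff.2 ⟨z', hz', by rwa [dist_comm]⟩)
    exact (hUV (Set.mk_mem_prod hyU hzV)).le
  · obtain ⟨_, ⟨z, hz, rfl⟩, hza⟩ := exists_lt_of_csInf_lt ((hZ i x).1.image _) ha
    have hO : {p : E d × 𝒵 | f p.1 p.2 < a} ∈ 𝓝 (x, z) :=
      (isOpen_lt hfc continuous_const).mem_nhds hza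
    rw [nhds_prod_eq, Filter.mem_prod_iff] at hO
    obtain ⟨U, hU, V, hV, hUV⟩ := hO
    obtain ⟨δ, hδ, hball⟩ := Metric.mem_nhds_iff.1 hV
    obtain ⟨δ', hδ', hdist⟩ := hH i x δ hδ
    filter_upwards [hU, Metric.ball_mem_nhds x hδ'] with y hyU hy
    obtain ⟨z', hz', hzz'⟩ := Metric.exists_dist_lt_of_hausdorffDist_lt hz (hdist y hy) (hfin x y)
    have hzV : z' ∈ V := hball (by rwa [Metric.mem_ball, dist_comm])
    exact (csInf_le (h2.bddBelow hub i y) ⟨z', hz', rfl⟩).trans_lt (hUV (Set.mk_mem_prod hyU hzV))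

lemma IsSupersolution.fobPen {P : HJBData d d' M 𝒜}
    {v : Fin M → E d → ℝ} (hv : IsSupersolution (Fhjb P) v) (Ψ : Fin M → E d → ℝ) {ρ : ℝ}
    (hρ : 0 ≤ ρ) : IsSupersolution (FobPen P Ψ ρ) v :=
  ⟨hv.1, fun i φ hφ x hx => add_nonneg (hv.2 i φ hφ x hx) (mul_nonneg hρ (le_max_right _ _))⟩

/-- Convergence of the auxiliary penalized iterates: under (H.1)–(H.4)
the iterates `u^{ρ,n}` converge monotonically from above to the penalized solution `u^ρ`,
uniformly on compact subsets of `ℝ^d`. -/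
theorem auxiliary_iterates_convergence
    {d d' M : ℕ} {𝒜 𝒵 : Type} [MetricSpace 𝒜] [MetricSpace 𝒵]
    (P : HJBData d d' M 𝒜) (Q : ImpulseData d M 𝒵) (C lam0 κ₀ C4 : ℝ)
    (h1 : H1 P C lam0) (h2 : H2 Q κ₀) (h3 : H3 P lam0) (h4 : H4 Q C4)
    (ρ : ℝ) (hρ : 0 ≤ ρ)
    (urn : ℕ → Fin M → E d → ℝ)
    (h0 : Bdd (urn 0) ∧ IsSolution (Fhjb P) (urn 0))
    (hstep : ∀ n : ℕ, Bdd (urn (n + 1)) ∧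
      IsSolution (FobPen P (fun i x => Q.Mop i (urn n) x) ρ) (urn (n + 1)))
    (urho : Fin M → E d → ℝ)
    (hrho : Bdd urho ∧ IsSolution (Fpen P Q ρ) urho) :
    (∀ (n : ℕ) (i : Fin M) (x : E d),
      urn (n + 1) i x ≤ urn n i x ∧ urho i x ≤ urn n i x) ∧
    ∀ Kset : Set (E d), IsCompact Kset → ∀ i : Fin M,
      TendstoUniformlyOn (fun n x => urn n i x) (urho i) Filter.atTop Kset := by
  have hlam := h1.1
  obtain ⟨hrhob, hrhoc, hrhosub, hrhosup⟩ := hrho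
  have hb : ∀ n, Bdd (urn n) := fun n => by cases n with
    | zero => exact h0.1
    | succ n => exact (hstep n).1
  have hc : ∀ n i, Continuous (urn n i) := fun n => by cases n with
    | zero => exact h0.2.1
    | succ n => exact (hstep n).2.1
  have hanti : ∀ n i x, urn (n + 1) i x ≤ urn n i x := by
    intro n
    induction n with
    | zero =>
      intro i x
      simpa using h1.comparison hρ (hb 1) (hb 0) (hc 1) (hc 0)
        (fun i => h2.continuous_Mop (hb 0) (hc 0) i) le_rfl (fun i x => (add_zero _).ge)
        (hstep 0).2.2.1 (h0.2.2.2.fobPen _ hρ) i x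
    | succ n ih =>
      intro i x
      simpa using h1.comparison hρ (hb (n + 2)) (hb (n + 1)) (hc (n + 2)) (hc (n + 1))
        (fun i => h2.continuous_Mop (hb (n + 1)) (hc (n + 1)) i) le_rfl
        (h2.Mop_le_add (hb (n + 1)) fun i x => by simpa using ih i x)
        (hstep (n + 1)).2.2.1 (hstep n).2.2.2 i x
  have hlower : ∀ n i x, urho i x ≤ urn n i x := by
    intro n
    induction n with
    | zero =>
      intro i x
      simpa using h1.comparison hρ hrhob (hb 0) hrhoc (hc 0)
        (fun i => h2.continuous_Mop hrhob hrhoc i) le_rfl (fun i x => (add_zero _).ge)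
        hrhosub (h0.2.2.2.fobPen _ hρ) i x
    | succ n ih =>
      intro i x
      simpa using h1.comparison hρ hrhob (hb (n + 1)) hrhoc (hc (n + 1))
        (fun i => h2.continuous_Mop hrhob hrhoc i) le_rfl
        (h2.Mop_le_add hrhob fun i x => by simpa using ih i x)
        hrhosub (hstep n).2.2.2 i x
  refine ⟨fun n i x => ⟨hanti n i x, hlower n i x⟩, fun Kset _ i => ?_⟩
  obtain ⟨D, hD0, hD⟩ : ∃ D, 0 ≤ D ∧ ∀ i x, urn 0 i x ≤ urho i x + D := by
    obtain ⟨b₁, hb₁⟩ := hb 0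
    obtain ⟨b₂, hb₂⟩ := hrhob
    have h := (abs_nonneg _).trans (hb₁ i 0)
    have h' := (abs_nonneg _).trans (hb₂ i 0)
    refine ⟨b₁ + b₂, add_nonneg h h', fun i x => ?_⟩
    have h₁ := (abs_le.1 (hb₁ i x)).2
    have h₂ := (abs_le.1 (hb₂ i x)).1
    linarith
  set q := ρ / (lam0 + ρ) with hq
  have hq0 : 0 ≤ q := by positivity
  have hq1 : q < 1 := (div_lt_one (by positivity)).2 (by linarith)
  have hupper : ∀ n i x, urn n i x ≤ urho i x + q ^ n * D := by
    intro n
    induction n with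
    | zero => simpa using hD
    | succ n ih =>
      intro i x
      rw [pow_succ', mul_assoc]
      exact h1.comparison hρ (hb (n + 1)) hrhob (hc (n + 1)) hrhoc
        (fun i => h2.continuous_Mop (hb n) (hc n) i) (by positivity)
        (h2.Mop_le_add (hb n) ih) (hstep n).2.2.1 hrhosup i x
  have hlim : Tendsto (fun n => q ^ n * D) atTop (𝓝 0) := by
    simpa using (tendsto_pow_atTop_nhds_zero_of_lt_one hq0 hq1).mul_const D
  refine Metric.tendstoUniformlyOn_iff.2 fun ε hε => ?_
  filter_upwards [hlim.eventually (gt_mem_nhds hε)] with n hn x _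
  rw [dist_comm, Real.dist_eq, abs_of_nonneg (sub_nonneg.2 (hlower n i x))]
  linarith [hupper n i x]
end HJBQVI
end
end

section
/- For given α > 0, μ ∈ (0,1) and γ ∈ ℕ, let φ^α: (0,∞) → ℝ be defined by φ^α(x) = α x^γ + μ^x. Then there exist a constant C > 0 depending only on γ and μ, and a threshold α₀ > 0, such that for all 0 < α < α₀: min_{n∈ℕ} φ^α(n) ≤ C α (−log α)^γ. -/
/-- For `α > 0`, `μ ∈ (0,1)` and `γ ∈ ℕ`, the function
`φ^α(x) = α x^γ + μ^x` satisfies `min_{n ∈ ℕ} φ^α(n) ≤ C α (−log α)^γ` for all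
sufficiently small `α > 0`, with `C` depending only on `γ` and `μ`. -/
theorem min_penalty_balance (γ : ℕ) (hγ : 1 ≤ γ) (μ : ℝ) (hμ0 : 0 < μ) (hμ1 : μ < 1) :
    ∃ Cc α₀ : ℝ, 0 < Cc ∧ 0 < α₀ ∧
      ∀ α : ℝ, 0 < α → α < α₀ →
        ∃ n : ℕ, 0 < n ∧
          α * (n : ℝ) ^ γ + μ ^ n ≤ Cc * α * (-Real.log α) ^ γ := by
  have hm : 0 < -Real.log μ := neg_pos.2 (Real.log_neg hμ0 hμ1)
  set m := -Real.log μ with hm_def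
  refine ⟨(1 / m + 1) ^ γ + 1, Real.exp (-1), by positivity, Real.exp_pos _, ?_⟩
  intro α hα hα₀
  have ht : 1 < -Real.log α := by
    have := (Real.log_lt_iff_lt_exp hα).2 hα₀
    linarith
  set t := -Real.log α with ht_def
  have ht0 : 0 < t := one_pos.trans ht
  have hn_lower : t ≤ ⌈t / m⌉₊ * m := (div_le_iff₀ hm).1 (Nat.le_ceil (t / m))
  have hn_upper : (⌈t / m⌉₊ : ℝ) ≤ (1 / m + 1) * t := by
    have h := (Nat.ceil_lt_add_one (div_pos ht0 hm).le).le
    have h' : (1 / m + 1) * t = t / m + t := by ring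
    linarith
  refine ⟨⌈t / m⌉₊, Nat.ceil_pos.2 (div_pos ht0 hm), ?_⟩
  have h_pow : (⌈t / m⌉₊ : ℝ) ^ γ ≤ (1 / m + 1) ^ γ * t ^ γ := by
    rw [← mul_pow]
    gcongr
  have h_exp : μ ^ ⌈t / m⌉₊ ≤ α := by
    rw [← Real.log_le_log_iff (pow_pos hμ0 _) hα, Real.log_pow]
    have h : Real.log μ = -m := by rw [hm_def, neg_neg]
    rw [h, mul_neg]
    linarith
  have h_one : 1 ≤ t ^ γ := one_le_pow₀ ht.le
  calc α * (⌈t / m⌉₊ : ℝ) ^ γ + μ ^ ⌈t / m⌉₊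
      ≤ α * ((1 / m + 1) ^ γ * t ^ γ) + α * t ^ γ := by
        gcongr
        exact h_exp.trans (le_mul_of_one_le_right hα.le h_one)
    _ = ((1 / m + 1) ^ γ + 1) * α * t ^ γ := by ring
end

section
/- Convergence of approximate optimal impulse controls: assume (H.1), (H.2), and that 0 ≤ u^ρ_i − u_i ≤ ω(ρ) on ℝ^d for all i and ρ, where ω(ρ) → 0 as ρ → ∞, u is the bounded viscosity solution of the HJBQVI system and u^ρ of the penalized systems. For a continuous bounded v = (v_i)_{i∈ℐ}, define 𝒵^v_i(x) = argmin_{z∈Z_i(x)}[v_i(Γ_i(x,z)) + K_i(x,z)]. Then for every i ∈ ℐ, every x in the action region S_i = {x : u_i(x) = (M_i u)(x)}, and every sequence (z^ρ)_{ρ>0} with z^ρ ∈ 𝒵^{u^ρ}_i(x) for all ρ, one has lim_{ρ→∞} inf{ d_Z(z^ρ, z) : z ∈ 𝒵^u_i(x) } = 0. Consequently, if 𝒵^u_i(x) is a singleton, then 𝒵^{u^ρ}_i(x) converges to 𝒵^u_i(x) in the Hausdorff metric as ρ → ∞. -/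
noncomputable section
open scoped BigOperators RealInnerProductSpace
open Filter Topology Matrix

namespace HJBQVI

variable {d d' M : ℕ}

variable {𝒜 𝒵 : Type} [MetricSpace 𝒜] [MetricSpace 𝒵]

/-- On a compact set, near-minimizers of a continuous function lie near the set of minimizers. -/
theorem exists_infDist_minimizers_lt {X : Type*} [PseudoMetricSpace X] {S : Set X}
    (hS : IsCompact S) {f : X → ℝ} (hf : ContinuousOn f S) {ε : ℝ} (hε : 0 < ε) :
    ∃ δ > (0 : ℝ), ∀ z ∈ S, (∀ z' ∈ S, f z < f z' + δ) →
      Metric.infDist z {y | y ∈ S ∧ ∀ y' ∈ S, f y ≤ f y'} < ε := by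
  set m : Set X := {y | y ∈ S ∧ ∀ y' ∈ S, f y ≤ f y'}
  have hT : IsCompact (S ∩ {z | ε ≤ Metric.infDist z m}) :=
    hS.inter_right (isClosed_le continuous_const (Metric.continuous_infDist_pt m))
  rcases (S ∩ {z | ε ≤ Metric.infDist z m}).eq_empty_or_nonempty with hT0 | hT0
  · refine ⟨1, one_pos, fun z hz _ => ?_⟩
    by_contra! hle
    exact (hT0 ▸ (⟨hz, hle⟩ : z ∈ S ∩ {z | ε ≤ Metric.infDist z m}) : z ∈ (∅ : Set X))
  · obtain ⟨t, ⟨htS, htε⟩, htmin⟩ := hT.exists_isMinOn hT0 (hf.mono Set.inter_subset_left)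
    have htm : ∃ y ∈ S, f y < f t := by
      by_contra! hle
      have h0 : Metric.infDist t m = 0 := Metric.infDist_zero_of_mem ⟨htS, hle⟩
      have hle' : ε ≤ Metric.infDist t m := htε
      linarith
    obtain ⟨y, hyS, hyt⟩ := htm
    refine ⟨f t - f y, sub_pos.2 hyt, fun z hz hzδ => ?_⟩
    by_contra! hle
    have h1 : f t ≤ f z := htmin ⟨hz, hle⟩
    have h2 := hzδ y hyS
    linarith

theorem H2.continuous_cost {Q : ImpulseData d M 𝒵} {κ₀ : ℝ} (h : H2 Q κ₀)
    {v : Fin M → E d → ℝ} {i : Fin M} (hv : Continuous (v i)) (x : E d) :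
    Continuous fun z => v i (Q.Γ i x z) + Q.K i x z := by
  obtain ⟨-, -, hΓ, hK, -, -⟩ := h
  exact (hv.comp ((hΓ i).comp (Continuous.prodMk_right x))).add
    ((hK i).comp (Continuous.prodMk_right x))

theorem H2.argminSet_nonempty {Q : ImpulseData d M 𝒵} {κ₀ : ℝ} (h : H2 Q κ₀)
    {v : Fin M → E d → ℝ} {i : Fin M} (hv : Continuous (v i)) (x : E d) :
    (argminSet Q v i x).Nonempty := by
  obtain ⟨z, hz, hmin⟩ := (h.2.1 i x).2.exists_isMinOn (h.2.1 i x).1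
    (h.continuous_cost hv x).continuousOn
  exact ⟨z, hz, fun z' hz' => hmin hz'⟩

/-- Minimizers for functions converging uniformly from above are eventually uniformly close to
the minimizers for the limit. -/
theorem H2.eventually_infDist_argminSet_lt {Q : ImpulseData d M 𝒵} {κ₀ : ℝ} (h : H2 Q κ₀)
    {u : Fin M → E d → ℝ} {uρ : ℝ → Fin M → E d → ℝ} {i : Fin M} (hu : Continuous (u i))
    {ω : ℝ → ℝ} (hω : Tendsto ω atTop (𝓝 0))
    (hest : ∀ ρ : ℝ, 0 < ρ → ∀ x : E d, 0 ≤ uρ ρ i x - u i x ∧ uρ ρ i x - u i x ≤ ω ρ)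
    (x : E d) {ε : ℝ} (hε : 0 < ε) :
    ∀ᶠ ρ in atTop, ∀ z ∈ argminSet Q (uρ ρ) i x,
      Metric.infDist z (argminSet Q u i x) < ε := by
  obtain ⟨δ, hδ, hclose⟩ := exists_infDist_minimizers_lt (h.2.1 i x).2
    (h.continuous_cost hu x).continuousOn hε
  filter_upwards [hω.eventually_lt_const hδ, eventually_gt_atTop 0] with ρ hρ hpos z hz
  refine hclose z hz.1 fun z' hz' => ?_
  have h1 := hz.2 z' hz'
  have h2 := (hest ρ hpos (Q.Γ i x z)).1
  have h3 := (hest ρ hpos (Q.Γ i x z')).2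
  linarith

/-- Convergence of approximate optimal impulse controls: for `x` in the
action region, any selection of minimizers for the penalized solutions accumulates on the
set of exact minimizers; if the latter is a singleton, the minimizer sets converge in the
Hausdorff metric. -/
theorem impulse_control_convergence
    {d d' M : ℕ} {𝒜 𝒵 : Type} [MetricSpace 𝒜] [MetricSpace 𝒵]
    (P : HJBData d d' M 𝒜) (Q : ImpulseData d M 𝒵) (C lam0 κ₀ : ℝ)
    (h1 : H1 P C lam0) (h2 : H2 Q κ₀)
    (u : Fin M → E d → ℝ) (hu : Bdd u ∧ IsSolution (Fqvi P Q) u)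
    (uρ : ℝ → Fin M → E d → ℝ)
    (huρ : ∀ ρ : ℝ, 0 < ρ → Bdd (uρ ρ) ∧ IsSolution (Fpen P Q ρ) (uρ ρ))
    (ω : ℝ → ℝ) (hωlim : Filter.Tendsto ω Filter.atTop (nhds 0))
    (hest : ∀ ρ : ℝ, 0 < ρ → ∀ (i : Fin M) (x : E d),
      0 ≤ uρ ρ i x - u i x ∧ uρ ρ i x - u i x ≤ ω ρ) :
    ∀ (i : Fin M) (x : E d), u i x = Q.Mop i u x →
      (∀ zρ : ℝ → 𝒵, (∀ ρ : ℝ, 0 < ρ → zρ ρ ∈ argminSet Q (uρ ρ) i x) →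
        Filter.Tendsto (fun ρ => Metric.infDist (zρ ρ) (argminSet Q u i x))
          Filter.atTop (nhds 0)) ∧
      ((∃ z₀ : 𝒵, argminSet Q u i x = {z₀}) →
        Filter.Tendsto (fun ρ =>
            Metric.hausdorffDist (argminSet Q (uρ ρ) i x) (argminSet Q u i x))
          Filter.atTop (nhds 0)) := by
  intro i x _
  have hclose : ∀ ε > (0 : ℝ), ∀ᶠ ρ in atTop, ∀ z ∈ argminSet Q (uρ ρ) i x,
      Metric.infDist z (argminSet Q u i x) < ε := fun ε hε =>
    h2.eventually_infDist_argminSet_lt (hu.2.1 i) hωlim (fun ρ hρ => hest ρ hρ i) x hε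
  refine ⟨fun zρ hzρ => ?_, ?_⟩
  · refine Metric.tendsto_nhds.2 fun ε hε => ?_
    filter_upwards [hclose ε hε, eventually_gt_atTop 0] with ρ hρ hpos
    rw [Real.dist_0_eq_abs, abs_of_nonneg Metric.infDist_nonneg]
    exact hρ _ (hzρ ρ hpos)
  · rintro ⟨z₀, hz₀⟩
    refine Metric.tendsto_nhds.2 fun ε hε => ?_
    filter_upwards [hclose (ε / 2) (half_pos hε), eventually_gt_atTop 0] with ρ hρ hpos
    rw [Real.dist_0_eq_abs, abs_of_nonneg Metric.hausdorffDist_nonneg]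
    simp only [hz₀, Metric.infDist_singleton] at hρ ⊢
    refine (Metric.hausdorffDist_le_of_mem_dist (half_pos hε).le
      (fun z hz => ⟨z₀, Set.mem_singleton z₀, (hρ z hz).le⟩) ?_).trans_lt (half_lt_self hε)
    rintro _ rfl
    obtain ⟨z, hz⟩ := h2.argminSet_nonempty ((huρ ρ hpos).2.1 i) x
    exact ⟨z, hz, (dist_comm _ _).trans_le (hρ z hz).le⟩
end HJBQVI
end
end

section
/- Global monotone convergence of policy iteration for the discretized penalized equation: under the discrete structural assumptions below, for every initial control ω^(0) ∈ 𝒜 the policy-iteration iterates (u^(k))_{k≥0} are well-defined bounded functions on ℐ×ℤ^d, satisfy u^(k) ≥ u^(k+1) componentwise for all k ≥ 0, and converge pointwise as k → ∞ to the unique bounded solution of the discrete equation sup_{ω∈𝒜}(Ã(ω)u − b̃(ω)) = 0. -/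
noncomputable section
open scoped BigOperators
open Filter Topology

namespace DiscretePI

/-- Coefficient data of the discretized penalized equation on the grid `ℐ × ℤ^d`. -/
structure DData (d M : ℕ) (𝒜 𝒵 : Type) where
  A : Fin M → Set 𝒜
  Z : Fin M → (Fin d → ℤ) → Set 𝒵
  θ : Fin M → (Fin d → ℤ) → 𝒜 → (Fin d → ℤ) → ℝ
  cc : Fin M → (Fin d → ℤ) → 𝒜 → ℝ
  dd : Fin M → Fin M → (Fin d → ℤ) → 𝒜 → ℝ
  ell : Fin M → (Fin d → ℤ) → 𝒜 → ℝ
  γ : Fin M → (Fin d → ℤ) → 𝒵 → (Fin d → ℤ) → ℝ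
  K : Fin M → (Fin d → ℤ) → 𝒵 → ℝ

variable {d M : ℕ} {𝒜 𝒵 : Type} [TopologicalSpace 𝒜] [TopologicalSpace 𝒵]

/-- The `(i,l)` component of `Ã(ω)u − b̃(ω)` for a pointwise control `(α, β, z)`. -/
def Gpt (D : DData d M 𝒜 𝒵) (ρ : ℝ) (α : 𝒜) (β : Bool) (z : 𝒵)
    (u : Fin M → (Fin d → ℤ) → ℝ) (i : Fin M) (l : Fin d → ℤ) : ℝ :=
  (∑' m : Fin d → ℤ, D.θ i l α m * (u i l - u i m)) + D.cc i l α * u i l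
    - (∑ j ∈ Finset.univ.erase i, D.dd i j l α * u j l) - D.ell i l α
    + (if β then ρ * (u i l - (∑' m : Fin d → ℤ, D.γ i l z m * u i m) - D.K i l z) else 0)

/-- Same, for a bundled control value. -/
def GptC (D : DData d M 𝒜 𝒵) (ρ : ℝ) (w : 𝒜 × Bool × 𝒵)
    (u : Fin M → (Fin d → ℤ) → ℝ) (i : Fin M) (l : Fin d → ℤ) : ℝ :=
  Gpt D ρ w.1 w.2.1 w.2.2 u i l

/-- Values of `(Ã(ω)u − b̃(ω))_{(i,l)}` over all admissible controls. -/
def valSet (D : DData d M 𝒜 𝒵) (ρ : ℝ) (u : Fin M → (Fin d → ℤ) → ℝ)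
    (i : Fin M) (l : Fin d → ℤ) : Set ℝ :=
  {r | ∃ α ∈ D.A i, ∃ β : Bool, ∃ z ∈ D.Z i l, r = Gpt D ρ α β z u i l}

/-- Uniform boundedness of a grid function. -/
def BddD (u : Fin M → (Fin d → ℤ) → ℝ) : Prop := ∃ B : ℝ, ∀ i l, |u i l| ≤ B

/-- Admissible extended controls `ω ∈ 𝒜 = Π_{(i,l)} (A_i × {0,1} × Z_{i,l})`. -/
def Admissible (D : DData d M 𝒜 𝒵) (ω : Fin M → (Fin d → ℤ) → 𝒜 × Bool × 𝒵) : Prop :=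
  ∀ i l, (ω i l).1 ∈ D.A i ∧ (ω i l).2.2 ∈ D.Z i l

/-- The discrete structural assumptions: compact nonempty control sets, bounded
coefficients continuous in the controls, nonnegative off-diagonal weights, strict
monotonicity `c − Σ_{j≠i} d ≥ λ₀ > 0`, interpolation weights `γ ∈ [0,1]` summing to 1,
and uniformly finite stencils. -/
def Assumptions (D : DData d M 𝒜 𝒵) (lam0 : ℝ) : Prop :=
  0 < lam0 ∧
  (∀ i, (D.A i).Nonempty ∧ IsCompact (D.A i)) ∧
  (∀ i l, (D.Z i l).Nonempty ∧ IsCompact (D.Z i l)) ∧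
  (∃ Cb : ℝ, ∀ i l, ∀ α ∈ D.A i,
      (∀ m, 0 ≤ D.θ i l α m) ∧ Summable (fun m => D.θ i l α m) ∧
      (∑' m : Fin d → ℤ, D.θ i l α m) ≤ Cb ∧
      |D.cc i l α| ≤ Cb ∧ |D.ell i l α| ≤ Cb ∧
      (∀ j, 0 ≤ D.dd i j l α ∧ D.dd i j l α ≤ Cb) ∧
      ∀ z ∈ D.Z i l, |D.K i l z| ≤ Cb) ∧
  (∀ i l, ∀ α ∈ D.A i,
      lam0 ≤ D.cc i l α - ∑ j ∈ Finset.univ.erase i, D.dd i j l α) ∧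
  (∀ i l, ∀ z ∈ D.Z i l,
      (∀ m, 0 ≤ D.γ i l z m ∧ D.γ i l z m ≤ 1) ∧
      HasSum (fun m => D.γ i l z m) 1) ∧
  (∀ i l m, Continuous fun α => D.θ i l α m) ∧
  (∀ i l, Continuous fun α => D.cc i l α) ∧
  (∀ i j l, Continuous fun α => D.dd i j l α) ∧
  (∀ i l, Continuous fun α => D.ell i l α) ∧
  (∀ i l m, Continuous fun z => D.γ i l z m) ∧
  (∀ i l, Continuous fun z => D.K i l z) ∧
  ∀ i l, ∃ S : Finset (Fin d → ℤ),
    (∀ α ∈ D.A i, ∀ m ∉ S, D.θ i l α m = 0) ∧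
    ∀ z ∈ D.Z i l, ∀ m ∉ S, D.γ i l z m = 0

/-- `G` is the `(i,l)` component `u ↦ a u(i,l) − L u − b` of an affine operator whose off-diagonal
part `L` is positive and whose diagonal dominates with margin `lam`. -/
def MonotoneRow (lam C B : ℝ) (i : Fin M) (l : Fin d → ℤ)
    (G : (Fin M → (Fin d → ℤ) → ℝ) → ℝ) : Prop :=
  ∃ (a b : ℝ) (L : (Fin M → (Fin d → ℤ) → ℝ) →L[ℝ] ℝ),
    (∀ u, 0 ≤ u → 0 ≤ L u) ∧ lam + L 1 ≤ a ∧ a ≤ C ∧ |b| ≤ B ∧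
    ∀ u, G u = a * u i l - L u - b

section Rows

variable {lam C B : ℝ}

lemma positive_functional_le {L : (Fin M → (Fin d → ℤ) → ℝ) →L[ℝ] ℝ}
    (hL : ∀ u, 0 ≤ u → 0 ≤ L u) {u : Fin M → (Fin d → ℤ) → ℝ} {s : ℝ}
    (h : ∀ i l, u i l ≤ s) : L u ≤ s * L 1 := by
  have h0 := hL (s • 1 - u) (fun i l => by simpa using h i l)
  rw [map_sub, map_smul, smul_eq_mul] at h0
  linarith

lemma MonotoneRow.continuous {i : Fin M} {l : Fin d → ℤ}
    {G : (Fin M → (Fin d → ℤ) → ℝ) → ℝ} (h : MonotoneRow lam C B i l G) : Continuous G := by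
  obtain ⟨a, b, L, -, -, -, -, hG⟩ := h
  rw [funext hG]
  fun_prop

/-- Decreasing the off-diagonal values can only increase a row. -/
lemma MonotoneRow.sub_le {i : Fin M} {l : Fin d → ℤ}
    {G : (Fin M → (Fin d → ℤ) → ℝ) → ℝ} (h : MonotoneRow lam C B i l G)
    {u v : Fin M → (Fin d → ℤ) → ℝ} (huv : ∀ i l, v i l ≤ u i l) :
    G u - G v ≤ C * (u i l - v i l) := by
  obtain ⟨a, b, L, hL, ha, haC, -, hG⟩ := h
  have h0 := hL (u - v) (fun i l => by simpa using huv i l)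
  have h1 := mul_le_mul_of_nonneg_right haC (sub_nonneg.2 (huv i l))
  rw [map_sub] at h0
  rw [hG, hG]
  linarith

lemma MonotoneRow.apply_neg_const_nonpos {i : Fin M} {l : Fin d → ℤ}
    {G : (Fin M → (Fin d → ℤ) → ℝ) → ℝ} (hlam : 0 < lam) (h : MonotoneRow lam C B i l G) :
    G (fun _ _ => -(B / lam)) ≤ 0 := by
  obtain ⟨a, b, L, hL, ha, haC, hb, hG⟩ := h
  have hB : 0 ≤ B / lam := div_nonneg ((abs_nonneg b).trans hb) hlam.le
  have e : (fun _ _ => -(B / lam) : Fin M → (Fin d → ℤ) → ℝ) = (-(B / lam)) • 1 := by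
    ext; simp
  rw [hG, e, map_smul, smul_eq_mul]
  have h1 := mul_le_mul_of_nonneg_left ha hB
  have h2 : B / lam * lam = B := div_mul_cancel₀ _ hlam.ne'
  have h3 := neg_abs_le b
  linarith

/-- Discrete comparison principle for bounded grid functions. -/
lemma comparison (hlam : 0 < lam) {u v : Fin M → (Fin d → ℤ) → ℝ} (hu : BddD u) (hv : BddD v)
    (h : ∀ i l, ∃ G, MonotoneRow lam C B i l G ∧ G u ≤ G v) (i : Fin M) (l : Fin d → ℤ) :
    u i l ≤ v i l := by
  by_contra! hlt
  obtain ⟨Bu, hBu⟩ := hu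
  obtain ⟨Bv, hBv⟩ := hv
  let e : Fin M × (Fin d → ℤ) → ℝ := fun x => u x.1 x.2 - v x.1 x.2
  have hbdd : BddAbove (Set.range e) := by
    refine ⟨Bu + Bv, ?_⟩
    rintro _ ⟨x, rfl⟩
    have h1 := (abs_le.1 (hBu x.1 x.2)).2
    have h2 := (abs_le.1 (hBv x.1 x.2)).1
    simp only [e]
    linarith
  have hle : ∀ i l, u i l - v i l ≤ iSup e := fun i l => le_ciSup hbdd (i, l)
  have hs : 0 < iSup e := (sub_pos.2 hlt).trans_le (hle i l)
  have : Nonempty (Fin M × (Fin d → ℤ)) := ⟨(i, l)⟩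
  have hC : 0 < C := by
    obtain ⟨G, ⟨a, b, L, hL, ha, haC, -⟩, -⟩ := h i l
    have := hL 1 (fun _ _ => zero_le_one)
    linarith
  have key : iSup e ≤ iSup e - iSup e * lam / C := by
    refine ciSup_le fun x => ?_
    obtain ⟨G, ⟨a, b, L, hL, ha, haC, hb, hG⟩, hGuv⟩ := h x.1 x.2
    have hL1 := hL 1 (fun _ _ => zero_le_one)
    have ha0 : 0 < a := by linarith
    have h1 : L (u - v) ≤ iSup e * L 1 := positive_functional_le hL (fun i l => hle i l)
    rw [map_sub] at h1
    rw [hG, hG] at hGuv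
    have h2 : a * e x ≤ iSup e * (a - lam) := by
      have := mul_le_mul_of_nonneg_left ha hs.le
      simp only [e]
      linarith
    have h3 : e x ≤ iSup e - iSup e * lam / a := by
      have : iSup e - iSup e * lam / a = iSup e * (a - lam) / a := by field_simp
      rw [this, le_div_iff₀ ha0]
      linarith
    have h4 : iSup e * lam / C ≤ iSup e * lam / a := by gcongr
    linarith
  have : 0 < iSup e * lam / C := by positivity
  linarith

lemma eq_of_rows_eq (hlam : 0 < lam) {G : Fin M → (Fin d → ℤ) → (Fin M → (Fin d → ℤ) → ℝ) → ℝ}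
    (hG : ∀ i l, MonotoneRow lam C B i l (G i l)) {u v : Fin M → (Fin d → ℤ) → ℝ}
    (hu : BddD u) (hv : BddD v) (h : ∀ i l, G i l u = G i l v) : u = v := by
  ext i l
  exact le_antisymm (comparison hlam hu hv (fun i l => ⟨_, hG i l, (h i l).le⟩) i l)
    (comparison hlam hv hu (fun i l => ⟨_, hG i l, (h i l).ge⟩) i l)

/-- A system of monotone rows has a bounded solution, by Banach's fixed point theorem. -/
lemma exists_bounded_solution (hlam : 0 < lam) (hlamC : lam ≤ C)
    {G : Fin M → (Fin d → ℤ) → (Fin M → (Fin d → ℤ) → ℝ) → ℝ}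
    (hG : ∀ i l, MonotoneRow lam C B i l (G i l)) :
    ∃ u, BddD u ∧ ∀ i l, G i l u = 0 := by
  have hC : 0 < C := hlam.trans_le hlamC
  choose a b L hL ha haC hb hG using hG
  have hL1 : ∀ i l, 0 ≤ L i l 1 := fun i l => hL i l 1 (fun _ _ => zero_le_one)
  have ha0 : ∀ i l, 0 < a i l := fun i l => by linarith [hL1 i l, ha i l]
  let q : ℝ := 1 - lam / C
  have hq0 : 0 ≤ q := sub_nonneg.2 ((div_le_one hC).2 hlamC)
  have hq1 : q < 1 := sub_lt_self _ (div_pos hlam hC)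
  have hcontr : ∀ i l (w : Fin M → (Fin d → ℤ) → ℝ) (s : ℝ), 0 ≤ s → (∀ i l, |w i l| ≤ s) →
      |L i l w / a i l| ≤ q * s := by
    intro i l w s hs hw
    have h1 := positive_functional_le (hL i l) (fun j m => (abs_le.1 (hw j m)).2)
    have h2 := positive_functional_le (u := -w) (hL i l)
      (fun j m => neg_le.1 (abs_le.1 (hw j m)).1)
    rw [map_neg] at h2
    have h3 : |L i l w| ≤ s * L i l 1 := abs_le.2 ⟨by linarith, h1⟩
    rw [abs_div, abs_of_pos (ha0 i l), div_le_iff₀ (ha0 i l)]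
    have h4 : a i l - lam ≤ q * a i l := by
      have : lam / C * a i l ≤ lam := by
        rw [div_mul_eq_mul_div, div_le_iff₀ hC]
        exact mul_le_mul_of_nonneg_left (haC i l) hlam.le
      simp only [q]
      linarith
    calc |L i l w| ≤ s * L i l 1 := h3
      _ ≤ s * (q * a i l) := by gcongr; linarith [ha i l]
      _ = q * s * a i l := by ring
  let cur : BoundedContinuousFunction (Fin M × (Fin d → ℤ)) ℝ → Fin M → (Fin d → ℤ) → ℝ :=
    fun f i l => f (i, l)
  have hcur : ∀ f i l, |cur f i l| ≤ ‖f‖ := fun f i l => f.norm_coe_le_norm (i, l)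
  let T : BoundedContinuousFunction (Fin M × (Fin d → ℤ)) ℝ →
      BoundedContinuousFunction (Fin M × (Fin d → ℤ)) ℝ := fun f =>
    BoundedContinuousFunction.ofNormedAddCommGroupDiscrete
      (fun x => (L x.1 x.2 (cur f) + b x.1 x.2) / a x.1 x.2) (q * ‖f‖ + B / lam) (by
        intro x
        rw [add_div]
        refine (norm_add_le _ _).trans (add_le_add ?_ ?_)
        · exact hcontr _ _ _ _ (norm_nonneg f) (hcur f)
        · rw [Real.norm_eq_abs, abs_div, abs_of_pos (ha0 _ _)]
          have : lam ≤ a x.1 x.2 := by linarith [hL1 x.1 x.2, ha x.1 x.2]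
          exact div_le_div₀ ((abs_nonneg _).trans (hb x.1 x.2)) (hb _ _) hlam this)
  have hT : ContractingWith ⟨q, hq0⟩ T := by
    refine ⟨hq1, LipschitzWith.of_dist_le_mul fun f g => ?_⟩
    rw [dist_eq_norm f g]
    refine (BoundedContinuousFunction.dist_le (by positivity)).2 fun x => ?_
    have h1 := hcontr x.1 x.2 (cur f - cur g) ‖f - g‖ (norm_nonneg _) (fun i l => hcur (f - g) i l)
    rw [map_sub] at h1
    rw [Real.dist_eq]
    change |(L x.1 x.2 (cur f) + b x.1 x.2) / a x.1 x.2
      - (L x.1 x.2 (cur g) + b x.1 x.2) / a x.1 x.2| ≤ _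
    rw [← sub_div, add_sub_add_right_eq_sub]
    exact h1
  have hfix : T (hT.fixedPoint T) = hT.fixedPoint T := hT.fixedPoint_isFixedPt
  refine ⟨cur (hT.fixedPoint T), ⟨_, hcur _⟩, fun i l => ?_⟩
  have h1 : (L i l (cur (hT.fixedPoint T)) + b i l) / a i l = cur (hT.fixedPoint T) i l :=
    DFunLike.congr_fun hfix (i, l)
  rw [div_eq_iff (ha0 i l).ne'] at h1
  rw [hG]
  linarith

/-- A bounded solution of a system of monotone rows is bounded below independently of the
system. -/
lemma neg_const_le_solution (hlam : 0 < lam)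
    {G : Fin M → (Fin d → ℤ) → (Fin M → (Fin d → ℤ) → ℝ) → ℝ}
    (hG : ∀ i l, MonotoneRow lam C B i l (G i l)) {u : Fin M → (Fin d → ℤ) → ℝ}
    (hu : BddD u) (h : ∀ i l, G i l u = 0) (i : Fin M) (l : Fin d → ℤ) : -(B / lam) ≤ u i l :=
  comparison (u := fun _ _ => -(B / lam)) hlam ⟨_, fun _ _ => le_rfl⟩ hu
    (fun i l => ⟨_, hG i l, ((hG i l).apply_neg_const_nonpos hlam).trans (h i l).ge⟩) i l

end Rows

set_option linter.unusedSectionVars false in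
lemma Gpt_eq_finset_sum (D : DData d M 𝒜 𝒵) (ρ : ℝ) {α : 𝒜} (β : Bool) {z : 𝒵} {i : Fin M}
    {l : Fin d → ℤ} {S : Finset (Fin d → ℤ)} (hθ : ∀ m ∉ S, D.θ i l α m = 0)
    (hγ : ∀ m ∉ S, D.γ i l z m = 0) (u : Fin M → (Fin d → ℤ) → ℝ) :
    Gpt D ρ α β z u i l = (∑ m ∈ S, D.θ i l α m * (u i l - u i m)) + D.cc i l α * u i l
      - (∑ j ∈ Finset.univ.erase i, D.dd i j l α * u j l) - D.ell i l α
      + (if β then ρ * (u i l - (∑ m ∈ S, D.γ i l z m * u i m) - D.K i l z) else 0) := by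
  rw [Gpt, tsum_eq_sum (s := S) (fun m hm => by rw [hθ m hm, zero_mul]),
    tsum_eq_sum (s := S) (fun m hm => by rw [hγ m hm, zero_mul])]

/-- Under the structural assumptions every admissible control produces a monotone row, with
constants independent of the control and of the grid point. -/
lemma Assumptions.exists_monotoneRow {D : DData d M 𝒜 𝒵} {ρ lam0 : ℝ} (hρ : 0 < ρ)
    (h : Assumptions D lam0) :
    ∃ C B : ℝ, lam0 ≤ C ∧ ∀ i l, ∀ α ∈ D.A i, ∀ β : Bool, ∀ z ∈ D.Z i l,
      MonotoneRow lam0 C B i l (fun u => Gpt D ρ α β z u i l) := by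
  obtain ⟨hlam, -, -, ⟨Cb, hCb⟩, hmono, hγ, -, -, -, -, -, -, hS⟩ := h
  refine ⟨lam0 + 2 * |Cb| + ρ, |Cb| + ρ * |Cb|, by linarith [abs_nonneg Cb], fun i l α hα β z hz => ?_⟩
  obtain ⟨S, hSθ, hSγ⟩ := hS i l
  obtain ⟨hθ0, -, hθs, hc, hell, hd, hK⟩ := hCb i l α hα
  obtain ⟨hγ0, hγ1⟩ := hγ i l z hz
  have hθsum : ∑ m ∈ S, D.θ i l α m ≤ Cb := by
    rwa [tsum_eq_sum (s := S) (hSθ α hα)] at hθs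
  have hγsum : ∑ m ∈ S, D.γ i l z m = 1 := by
    exact (hasSum_sum_of_ne_finset_zero (hSγ z hz)).unique hγ1
  have hC := le_abs_self Cb
  let r : ℝ := if β then ρ else 0
  have hr0 : 0 ≤ r := by simp only [r]; split_ifs <;> linarith
  have hr1 : r ≤ ρ := by simp only [r]; split_ifs <;> linarith
  let L : (Fin M → (Fin d → ℤ) → ℝ) →L[ℝ] ℝ :=
    ∑ m ∈ S, (D.θ i l α m + r * D.γ i l z m) •
        (ContinuousLinearMap.proj m ∘L ContinuousLinearMap.proj i)
      + ∑ j ∈ Finset.univ.erase i, D.dd i j l α •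
        (ContinuousLinearMap.proj l ∘L ContinuousLinearMap.proj j)
  have hL : ∀ u, L u = ∑ m ∈ S, (D.θ i l α m + r * D.γ i l z m) * u i m
      + ∑ j ∈ Finset.univ.erase i, D.dd i j l α * u j l := by
    intro u
    simp [L]
  refine ⟨∑ m ∈ S, D.θ i l α m + D.cc i l α + r, D.ell i l α + r * D.K i l z, L,
    fun u hu => ?_, ?_, ?_, ?_, fun u => ?_⟩
  · rw [hL]
    refine add_nonneg (Finset.sum_nonneg fun m _ => mul_nonneg ?_ (hu i m))
      (Finset.sum_nonneg fun j _ => mul_nonneg (hd j).1 (hu j l))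
    exact add_nonneg (hθ0 m) (mul_nonneg hr0 (hγ0 m).1)
  · have := hmono i l α hα
    simp only [hL, Pi.one_apply, mul_one, Finset.sum_add_distrib, ← Finset.mul_sum, hγsum]
    linarith
  · have := (abs_le.1 hc).2
    linarith
  · refine (abs_add_le _ _).trans (add_le_add (hell.trans hC) ?_)
    rw [abs_mul, abs_of_nonneg hr0]
    exact mul_le_mul hr1 ((hK z hz).trans hC) (abs_nonneg _) hρ.le
  · beta_reduce
    rw [Gpt_eq_finset_sum D ρ β (hSθ α hα) (hSγ z hz), hL]
    have e1 : (if β then ρ * (u i l - (∑ m ∈ S, D.γ i l z m * u i m) - D.K i l z) else 0)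
        = r * (u i l - (∑ m ∈ S, D.γ i l z m * u i m) - D.K i l z) := by
      simp only [r]; split_ifs <;> ring
    rw [e1]
    simp only [mul_sub, add_mul, Finset.sum_add_distrib, Finset.sum_sub_distrib,
      ← Finset.sum_mul, mul_assoc, ← Finset.mul_sum]
    ring

/-- The supremum over the controls is attained. -/
lemma Assumptions.exists_isGreatest {D : DData d M 𝒜 𝒵} (ρ : ℝ) {lam0 : ℝ}
    (h : Assumptions D lam0) (u : Fin M → (Fin d → ℤ) → ℝ) (i : Fin M) (l : Fin d → ℤ) :
    ∃ w : 𝒜 × Bool × 𝒵, (w.1 ∈ D.A i ∧ w.2.2 ∈ D.Z i l) ∧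
      IsGreatest (valSet D ρ u i l) (GptC D ρ w u i l) := by
  obtain ⟨-, hA, hZ, -, -, -, hθ, hc, hd, hell, hγ, hK, hS⟩ := h
  obtain ⟨S, hSθ, hSγ⟩ := hS i l
  have hcomp : IsCompact (D.A i ×ˢ ((Set.univ : Set Bool) ×ˢ D.Z i l)) :=
    (hA i).2.prod (isCompact_univ.prod (hZ i l).2)
  have hne : (D.A i ×ˢ ((Set.univ : Set Bool) ×ˢ D.Z i l)).Nonempty :=
    (hA i).1.prod (Set.univ_nonempty.prod (hZ i l).1)
  have hcont : ContinuousOn (fun w => GptC D ρ w u i l)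
      (D.A i ×ˢ ((Set.univ : Set Bool) ×ˢ D.Z i l)) := by
    have : Continuous fun w : 𝒜 × Bool × 𝒵 =>
        (∑ m ∈ S, D.θ i l w.1 m * (u i l - u i m)) + D.cc i l w.1 * u i l
        - (∑ j ∈ Finset.univ.erase i, D.dd i j l w.1 * u j l) - D.ell i l w.1
        + (if w.2.1 then (1 : ℝ) else 0)
          * (ρ * (u i l - (∑ m ∈ S, D.γ i l w.2.2 m * u i m) - D.K i l w.2.2)) := by
      have hβ : Continuous fun w : 𝒜 × Bool × 𝒵 => if w.2.1 then (1 : ℝ) else 0 :=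
        (continuous_of_discreteTopology (f := fun β : Bool => if β then (1 : ℝ) else 0)).comp
          (continuous_fst.comp continuous_snd)
      have hθ' := fun m => (hθ i l m).comp (continuous_fst (X := 𝒜) (Y := Bool × 𝒵))
      have hd' := fun j => (hd i j l).comp (continuous_fst (X := 𝒜) (Y := Bool × 𝒵))
      have hc' := (hc i l).comp (continuous_fst (X := 𝒜) (Y := Bool × 𝒵))
      have hell' := (hell i l).comp (continuous_fst (X := 𝒜) (Y := Bool × 𝒵))
      have hz : Continuous fun w : 𝒜 × Bool × 𝒵 => w.2.2 := continuous_snd.comp continuous_snd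
      have hγ' := fun m => (hγ i l m).comp hz
      have hK' := (hK i l).comp hz
      simp only [Function.comp_def] at hθ' hd' hc' hell' hγ' hK'
      fun_prop
    refine this.continuousOn.congr fun w hw => ?_
    simp only [GptC]
    rw [Gpt_eq_finset_sum D ρ w.2.1 (hSθ _ hw.1) (hSγ _ hw.2.2)]
    split_ifs <;> ring
  obtain ⟨w, hw, hmax⟩ := hcomp.exists_isMaxOn hne hcont
  refine ⟨w, ⟨hw.1, hw.2.2⟩, ⟨w.1, hw.1, w.2.1, w.2.2, hw.2.2, rfl⟩, ?_⟩
  rintro _ ⟨α, hα, β, z, hz, rfl⟩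
  exact hmax (show (α, β, z) ∈ _ from ⟨hα, Set.mem_univ _, hz⟩)

/-- Global monotone convergence of policy iteration for the discretized
penalized equation: for every initial control the policy-iteration iterates are
well-defined, decrease monotonically, and converge pointwise to the unique bounded
solution of `sup_{ω ∈ 𝒜}(Ã(ω)u − b̃(ω)) = 0`. -/
theorem policy_iteration_global_convergence
    (D : DData d M 𝒜 𝒵) (ρ lam0 : ℝ) (hρ : 0 < ρ) (hass : Assumptions D lam0)
    (ω0 : Fin M → (Fin d → ℤ) → 𝒜 × Bool × 𝒵) (hω0 : Admissible D ω0) :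
    ∃ (useq : ℕ → Fin M → (Fin d → ℤ) → ℝ)
      (ωseq : ℕ → Fin M → (Fin d → ℤ) → 𝒜 × Bool × 𝒵)
      (ustar : Fin M → (Fin d → ℤ) → ℝ),
      ωseq 0 = ω0 ∧
      (∀ k, Admissible D (ωseq k)) ∧
      (∀ k, BddD (useq k)) ∧
      (∀ k i l, GptC D ρ (ωseq k i l) (useq k) i l = 0) ∧
      (∀ k w, BddD w → (∀ i l, GptC D ρ (ωseq k i l) w i l = 0) → w = useq k) ∧
      (∀ k i l,
        GptC D ρ (ωseq (k + 1) i l) (useq k) i l = sSup (valSet D ρ (useq k) i l)) ∧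
      (∀ k i l, useq (k + 1) i l ≤ useq k i l) ∧
      BddD ustar ∧
      (∀ i l, sSup (valSet D ρ ustar i l) = 0) ∧
      (∀ w, BddD w → (∀ i l, sSup (valSet D ρ w i l) = 0) → w = ustar) ∧
      ∀ i l, Filter.Tendsto (fun k => useq k i l) Filter.atTop (nhds (ustar i l)) := by
  obtain ⟨C, B, hlamC, hrow⟩ := hass.exists_monotoneRow hρ
  have hlam : 0 < lam0 := hass.1
  have hrowC : ∀ ω, Admissible D ω → ∀ i l,
      MonotoneRow lam0 C B i l (fun u => GptC D ρ (ω i l) u i l) :=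
    fun ω hω i l => hrow i l _ (hω i l).1 _ _ (hω i l).2
  choose g hgA hg using fun u i l => hass.exists_isGreatest ρ u i l
  have hsup : ∀ u i l, sSup (valSet D ρ u i l) = GptC D ρ (g u i l) u i l :=
    fun u i l => (hg u i l).csSup_eq
  have hle : ∀ ω, Admissible D ω → ∀ u i l,
      GptC D ρ (ω i l) u i l ≤ GptC D ρ (g u i l) u i l :=
    fun ω hω u i l => (hg u i l).2 ⟨_, (hω i l).1, _, _, (hω i l).2, rfl⟩
  choose! sol hsolB hsol using fun ω (hω : Admissible D ω) =>
    exists_bounded_solution hlam hlamC (hrowC ω hω)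
  let ωseq : ℕ → Fin M → (Fin d → ℤ) → 𝒜 × Bool × 𝒵 :=
    fun k => Nat.rec ω0 (fun _ ω => g (sol ω)) k
  have hadm : ∀ k, Admissible D (ωseq k) := by
    intro k
    cases k with
    | zero => exact hω0
    | succ k => exact hgA _
  let useq := fun k => sol (ωseq k)
  have hωsucc : ∀ k, ωseq (k + 1) = g (useq k) := fun _ => rfl
  have huB : ∀ k, BddD (useq k) := fun k => hsolB _ (hadm k)
  have hu0 : ∀ k i l, GptC D ρ (ωseq k i l) (useq k) i l = 0 := fun k => hsol _ (hadm k)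
  have hmono : ∀ k i l, useq (k + 1) i l ≤ useq k i l := fun k =>
    comparison hlam (huB (k + 1)) (huB k) fun i l => ⟨_, hrowC _ (hadm (k + 1)) i l, by
      rw [hu0 (k + 1) i l, ← hu0 k i l]
      exact hle _ (hadm k) (useq k) i l⟩
  have hanti : ∀ i l, Antitone fun k => useq k i l :=
    fun i l => antitone_nat_of_succ_le fun k => hmono k i l
  have hlow : ∀ k i l, -(B / lam0) ≤ useq k i l := fun k =>
    neg_const_le_solution hlam (hrowC _ (hadm k)) (huB k) (hu0 k)
  have hbdd : ∀ i l, BddBelow (Set.range fun k => useq k i l) := fun i l =>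
    ⟨-(B / lam0), by rintro _ ⟨k, rfl⟩; exact hlow k i l⟩
  let ustar : Fin M → (Fin d → ℤ) → ℝ := fun i l => ⨅ k, useq k i l
  have hstar_le : ∀ k i l, ustar i l ≤ useq k i l := fun k i l => ciInf_le (hbdd i l) k
  have hlim : ∀ i l, Tendsto (fun k => useq k i l) atTop (𝓝 (ustar i l)) :=
    fun i l => tendsto_atTop_ciInf (hanti i l) (hbdd i l)
  have hstarB : BddD ustar := by
    obtain ⟨B0, hB0⟩ := huB 0
    refine ⟨max B0 (B / lam0), fun i l => abs_le.2 ⟨?_, ?_⟩⟩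
    · exact (neg_le_neg (le_max_right _ _)).trans (le_ciInf fun k => hlow k i l)
    · exact ((hstar_le 0 i l).trans (abs_le.1 (hB0 i l)).2).trans (le_max_left _ _)
  have hstar_nonpos : ∀ i l, GptC D ρ (g ustar i l) ustar i l ≤ 0 := by
    intro i l
    have h1 : Tendsto (fun k => GptC D ρ (g ustar i l) (useq k) i l) atTop
        (𝓝 (GptC D ρ (g ustar i l) ustar i l)) :=
      ((hrowC _ (hgA ustar) i l).continuous.tendsto ustar).comp
        (tendsto_pi_nhds.2 fun i => tendsto_pi_nhds.2 fun l => hlim i l)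
    have h2 : Tendsto (fun k => C * (useq k i l - useq (k + 1) i l)) atTop (𝓝 0) := by
      simpa using ((hlim i l).sub ((hlim i l).comp (tendsto_add_atTop_nat 1))).const_mul C
    refine le_of_tendsto_of_tendsto' h1 h2 fun k => ?_
    have h3 := (hrowC _ (hadm (k + 1)) i l).sub_le (hmono k)
    rw [hu0 (k + 1) i l, sub_zero, hωsucc] at h3
    exact (hle _ (hgA ustar) (useq k) i l).trans h3
  have hstar_nonneg : ∀ i l, 0 ≤ GptC D ρ (g ustar i l) ustar i l := by
    intro i l
    have h2 : Tendsto (fun k => -(C * (useq k i l - ustar i l))) atTop (𝓝 0) := by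
      simpa using (((hlim i l).sub_const (ustar i l)).const_mul C).neg
    refine le_of_tendsto' h2 fun k => ?_
    have h3 := (hrowC _ (hadm k) i l).sub_le (hstar_le k)
    have h4 := hle _ (hadm k) ustar i l
    rw [hu0 k i l] at h3
    linarith
  have hstar0 : ∀ i l, sSup (valSet D ρ ustar i l) = 0 := fun i l => by
    rw [hsup]
    exact le_antisymm (hstar_nonpos i l) (hstar_nonneg i l)
  have hsuple : ∀ v w, BddD v → BddD w → (∀ i l, sSup (valSet D ρ v i l) = 0) →
      (∀ i l, sSup (valSet D ρ w i l) = 0) → ∀ i l, v i l ≤ w i l := by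
    intro v w hv hw hv0 hw0
    refine comparison hlam hv hw fun i l => ⟨_, hrowC _ (hgA w) i l, ?_⟩
    rw [← hsup w i l, hw0, ← hv0 i l, hsup]
    exact hle _ (hgA w) v i l
  refine ⟨useq, ωseq, ustar, rfl, hadm, huB, hu0, fun k w hw hw0 => ?_, fun k i l => ?_, hmono,
    hstarB, hstar0, fun w hw hw0 => ?_, hlim⟩
  · exact eq_of_rows_eq hlam (hrowC _ (hadm k)) hw (huB k)
      fun i l => (hw0 i l).trans (hu0 k i l).symm
  · rw [hsup, hωsucc]
  · ext i l
    exact le_antisymm (hsuple _ _ hw hstarB hw0 hstar0 i l) (hsuple _ _ hstarB hw hstar0 hw0 i l)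

end DiscretePI
end
end
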